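/- Let D be a compact subset of (Ē_K, Ē_Na) × (0,1)³ in (v,m,h,n)-space and let K be a compact subset of {(v,h,n) : v ∈ (Ē_K, Ē_Na), h ∈ (0,1), n ∈ (0,1), μ(v,h,n) ∈ (0,1)}. Fix ε > 0, δ_h > 0, δ_n > 0 and T_m, T_h, T_n > 0. Then there exist γ₀ > 0 and C > 0 such that for every γ ∈ (0, γ₀) there is a continuously differentiable function μ_γ : ℝ³ → ℝ with |μ_γ(v,h,n) − μ(v,h,n)| ≤ C·γ for all (v,h,n) ∈ K, whose graph {m = μ_γ(v,h,n)} is locally invariant under the flow of the system v' = V(v,m,h,n), m' = γ·(m_∞(v) − m)/(T_m·t̂_m(v)), h' = γ·ε·δ_h·(h_∞(v) − h)/(T_h·t̂_h(v)), n' = γ·ε·δ_n·(n_∞(v) − n)/(T_n·t̂_n(v)); that is, every solution t ↦ (v(t),m(t),h(t),n(t)) of this system on an interval [t₀,t₁] with (v(t),h(t),n(t)) ∈ K for all t ∈ [t₀,t₁] and m(t₀) = μ_γ(v(t₀),h(t₀),n(t₀)) satisfies m(t) = μ_γ(v(t),h(t),n(t)) for all t ∈ [t₀,t₁]. -/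

import Mathlib

open Real Set Filter

noncomputable section

/-- Nernst potential of sodium (rescaled). -/
def ENa : ℝ := 0.5
/-- Nernst potential of potassium (rescaled). -/
def EK : ℝ := -0.77
/-- Nernst potential of the leak current (rescaled). -/
def EL : ℝ := -0.544
/-- Rescaled potassium conductance. -/
def gK : ℝ := 0.3
/-- Rescaled leak conductance. -/
def gL : ℝ := 0.0025

/-- The right-hand side of the fast voltage equation. -/
def V (I v m h n : ℝ) : ℝ :=
  I - (v - ENa) * m ^ 3 * h - gK * (v - EK) * n ^ 4 - gL * (v - EL)

def αm (v : ℝ) : ℝ := ((v + 40) / 10) / (1 - Real.exp (-(v + 40) / 10))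
def βm (v : ℝ) : ℝ := 4 * Real.exp (-(v + 65) / 18)
def αh (v : ℝ) : ℝ := (7 / 100) * Real.exp (-(v + 65) / 20)
def βh (v : ℝ) : ℝ := 1 / (1 + Real.exp (-(v + 35) / 10))
def αn (v : ℝ) : ℝ := ((v + 55) / 100) / (1 - Real.exp (-(v + 55) / 10))
def βn (v : ℝ) : ℝ := (1 / 4) * Real.exp (-(v + 65) / 80)

def minf (v : ℝ) : ℝ := αm v / (αm v + βm v)
def hinf (v : ℝ) : ℝ := αh v / (αh v + βh v)
def ninf (v : ℝ) : ℝ := αn v / (αn v + βn v)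
def tmhat (v : ℝ) : ℝ := 1 / (αm v + βm v)
def thhat (v : ℝ) : ℝ := 1 / (αh v + βh v)
def tnhat (v : ℝ) : ℝ := 1 / (αn v + βn v)

/-- The real, sign-preserving cube root: `cbrt s = sign s * |s| ^ (1/3)`. -/
def cbrt (s : ℝ) : ℝ := Real.sign s * |s| ^ ((1 : ℝ) / 3)

/-- Graph representation `m = μ(v,h,n)` of the critical manifold. -/
def μfun (I v h n : ℝ) : ℝ :=
  cbrt ((I - gK * (v - EK) * n ^ 4 - gL * (v - EL)) / ((v - ENa) * h))

/-- Graph representation `h = η(v,n)` of the two-dimensional critical manifold. -/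
def ηfun (I v n : ℝ) : ℝ :=
  (I - gK * (v - EK) * n ^ 4 - gL * (v - EL)) / ((v - ENa) * (minf v) ^ 3)

/-- Graph representation `n = ν(v,h)` of the two-dimensional critical manifold
(nonnegative real fourth root). -/
def νfun (I v h : ℝ) : ℝ :=
  ((I - (v - ENa) * (minf v) ^ 3 * h - gL * (v - EL)) / (gK * (v - EK))) ^ ((1 : ℝ) / 4)

/-- `H(v,h) = (h_∞(v) - h)/(T_h · t̂_h(v))`. -/
def Hfun (Th v h : ℝ) : ℝ := (hinf v - h) / (Th * thhat v)

/-- `N(v,n) = (n_∞(v) - n)/(T_n · t̂_n(v))`. -/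
def Nfun (Tn v n : ℝ) : ℝ := (ninf v - n) / (Tn * tnhat v)


namespace Slow
open MeasureTheory

section
variable {E Z : Type*} [NormedAddCommGroup E] [NormedSpace ℝ E] [CompleteSpace E]
  [NormedAddCommGroup Z] [NormedSpace ℝ Z] [CompleteSpace Z]

def Iz (l : ℝ) (q : ℝ → Z) (t : ℝ) : Z := Real.exp (-l * t) • ∫ s in Set.Iic t, Real.exp (l * s) • q s

theorem intw_pos {f : ℝ → E} (hf : Continuous f) {σ N : ℝ} (hσ : 0 < σ)
    (hb : ∀ t, ‖f t‖ ≤ N * Real.exp (σ * |t|)) {t : ℝ} (ht : 0 ≤ t) :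
    ‖∫ r in (0:ℝ)..t, f r‖ ≤ N / σ * (Real.exp (σ * |t|) - 1) := by
  have h1 : ‖∫ r in (0:ℝ)..t, f r‖ ≤ ∫ r in (0:ℝ)..t, N * Real.exp (σ * r) := by
    apply intervalIntegral.norm_integral_le_of_norm_le ht
    · refine Filter.Eventually.of_forall fun r hr => ?_
      have := hb r
      rwa [abs_of_pos hr.1] at this
    · apply Continuous.intervalIntegrable; fun_prop
  have h2 : ∫ r in (0:ℝ)..t, N * Real.exp (σ * r) =
      N / σ * Real.exp (σ * t) - N / σ * Real.exp (σ * 0) := by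
    apply intervalIntegral.integral_eq_sub_of_hasDerivAt
    · intro x _
      have := (((hasDerivAt_id' x).const_mul σ).exp).const_mul (N / σ)
      refine this.congr_deriv ?_
      field_simp
    · apply Continuous.intervalIntegrable; fun_prop
  rw [abs_of_nonneg ht]
  calc _ ≤ _ := h1
    _ = _ := by rw [h2]; simp; ring

theorem intw_bound {f : ℝ → E} (hf : Continuous f) {σ N : ℝ} (hσ : 0 < σ)
    (hb : ∀ t, ‖f t‖ ≤ N * Real.exp (σ * |t|)) (t : ℝ) :
    ‖∫ r in (0:ℝ)..t, f r‖ ≤ N / σ * (Real.exp (σ * |t|) - 1) := by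
  rcases le_total 0 t with ht | ht
  · exact intw_pos hf hσ hb ht
  · have h := intw_pos (f := fun r => f (-r)) (by fun_prop) hσ
      (fun s => by have := hb (-s); rwa [abs_neg] at this) (t := -t) (by linarith)
    rw [intervalIntegral.integral_comp_neg, abs_neg] at h
    rw [intervalIntegral.integral_symm, norm_neg]
    simpa using h

theorem expw {l σ N : ℝ} (h : σ < l) (hσ : 0 < σ) (hN : 0 ≤ N) {q : ℝ → Z}
    (hb : ∀ t, ‖q t‖ ≤ N * Real.exp (σ * |t|)) (t s : ℝ) (hs : s ≤ t) :
    ‖Real.exp (l * s) • q s‖ ≤ N * Real.exp (σ * |t| + σ * t) * Real.exp ((l - σ) * s) := by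
  rw [norm_smul, Real.norm_eq_abs, abs_of_pos (Real.exp_pos _)]
  have h1 : |s| ≤ |t| + (t - s) := by
    have := abs_sub_abs_le_abs_sub s t
    rw [abs_sub_comm, abs_of_nonneg (sub_nonneg.2 hs)] at this
    linarith
  calc _ ≤ Real.exp (l * s) * (N * Real.exp (σ * |s|)) := by gcongr; exact hb s
    _ ≤ Real.exp (l * s) * (N * Real.exp (σ * (|t| + (t - s)))) := by gcongr
    _ = N * (Real.exp (l * s) * Real.exp (σ * (|t| + (t - s)))) := by ring
    _ = N * (Real.exp (σ * |t| + σ * t) * Real.exp ((l - σ) * s)) := by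
      rw [← Real.exp_add, ← Real.exp_add]; ring_nf
    _ = _ := by ring

theorem Iz_int {l σ N : ℝ} (h : σ < l) (hσ : 0 < σ) {q : ℝ → Z} (hq : Continuous q)
    (hb : ∀ t, ‖q t‖ ≤ N * Real.exp (σ * |t|)) (t : ℝ) :
    IntegrableOn (fun s => Real.exp (l * s) • q s) (Set.Iic t) := by
  have hN : 0 ≤ N := by have := (norm_nonneg _).trans (hb 0); simpa using this
  refine Integrable.mono' (((integrableOn_exp_mul_Iic (sub_pos.2 h) t)).const_mul
    (N * Real.exp (σ * |t| + σ * t))) ?_ ?_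
  · apply Continuous.aestronglyMeasurable; fun_prop
  · refine (ae_restrict_iff' measurableSet_Iic).2 (Filter.Eventually.of_forall fun s hs => ?_)
    exact expw h hσ hN hb t s hs

theorem Iz_bound {l σ N : ℝ} (h : σ < l) (hσ : 0 < σ) {q : ℝ → Z} (hq : Continuous q)
    (hb : ∀ t, ‖q t‖ ≤ N * Real.exp (σ * |t|)) (t : ℝ) :
    ‖Iz l q t‖ ≤ N / (l - σ) * Real.exp (σ * |t|) := by
  have hN : 0 ≤ N := by have := (norm_nonneg _).trans (hb 0); simpa using this
  unfold Iz
  rw [norm_smul, Real.norm_eq_abs, abs_of_pos (Real.exp_pos _)]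
  have h1 : ‖∫ s in Set.Iic t, Real.exp (l * s) • q s‖ ≤
      ∫ s in Set.Iic t, N * Real.exp (σ * |t| + σ * t) * Real.exp ((l - σ) * s) := by
    apply norm_integral_le_of_norm_le
    · exact ((integrableOn_exp_mul_Iic (sub_pos.2 h) t)).const_mul _
    · refine (ae_restrict_iff' measurableSet_Iic).2 (Filter.Eventually.of_forall fun s hs => ?_)
      exact expw h hσ hN hb t s hs
  rw [integral_const_mul, integral_exp_mul_Iic (sub_pos.2 h)] at h1
  calc _ ≤ Real.exp (-l * t) * (N * Real.exp (σ * |t| + σ * t) * (Real.exp ((l - σ) * t) / (l - σ))) := by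
        gcongr
    _ = N / (l - σ) * (Real.exp (-l * t) * Real.exp (σ * |t| + σ * t) * Real.exp ((l - σ) * t)) := by ring
    _ = _ := by rw [← Real.exp_add, ← Real.exp_add]; ring_nf

theorem Iz_bound0 {l N : ℝ} (h : 0 < l) {q : ℝ → Z} 
    (hb : ∀ t, ‖q t‖ ≤ N) (t : ℝ) :
    ‖Iz l q t‖ ≤ N / l := by
  unfold Iz
  rw [norm_smul, Real.norm_eq_abs, abs_of_pos (Real.exp_pos _)]
  have h1 : ‖∫ s in Set.Iic t, Real.exp (l * s) • q s‖ ≤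
      ∫ s in Set.Iic t, N * Real.exp (l * s) := by
    apply norm_integral_le_of_norm_le
    · exact ((integrableOn_exp_mul_Iic h t)).const_mul _
    · refine Filter.Eventually.of_forall fun s => ?_
      rw [norm_smul, Real.norm_eq_abs, abs_of_pos (Real.exp_pos _), mul_comm]
      gcongr; exact hb s
  rw [integral_const_mul, integral_exp_mul_Iic h] at h1
  calc _ ≤ Real.exp (-l * t) * (N * (Real.exp (l * t) / l)) := by gcongr
    _ = N / l * (Real.exp (-l * t) * Real.exp (l * t)) := by ring
    _ = _ := by rw [← Real.exp_add]; simp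

theorem Iz_deriv {l σ N : ℝ} (h : σ < l) (hσ : 0 < σ) {q : ℝ → Z} (hq : Continuous q)
    (hb : ∀ t, ‖q t‖ ≤ N * Real.exp (σ * |t|)) (t : ℝ) :
    HasDerivAt (Iz l q) (-l • Iz l q t + q t) t := by
  have hc : Continuous fun s => Real.exp (l * s) • q s := by fun_prop
  have h1 : ∀ t, ∫ s in Set.Iic t, Real.exp (l * s) • q s =
      (∫ s in Set.Iic 0, Real.exp (l * s) • q s) + ∫ s in (0:ℝ)..t, Real.exp (l * s) • q s := by
    intro t
    rw [← intervalIntegral.integral_Iic_sub_Iic (Iz_int h hσ hq hb 0) (Iz_int h hσ hq hb t)]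
    abel
  have h2 : HasDerivAt (fun t => ∫ s in Set.Iic t, Real.exp (l * s) • q s)
      (Real.exp (l * t) • q t) t := by
    rw [funext h1]
    exact ((intervalIntegral.integral_hasDerivAt_right (hc.intervalIntegrable _ _)
      hc.aestronglyMeasurable.stronglyMeasurableAtFilter hc.continuousAt)).const_add _
  have h3 : HasDerivAt (fun t => Real.exp (-l * t)) (-l * Real.exp (-l * t)) t := by
    have := ((hasDerivAt_id' t).const_mul (-l)).exp
    refine this.congr_deriv ?_; ring
  have := h3.smul h2
  refine HasDerivAt.congr_deriv (f := Iz l q) this ?_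
  unfold Iz
  rw [smul_smul, smul_smul, ← Real.exp_add, add_comm]
  simp

theorem Iz_cont {l σ N : ℝ} (h : σ < l) (hσ : 0 < σ) {q : ℝ → Z} (hq : Continuous q)
    (hb : ∀ t, ‖q t‖ ≤ N * Real.exp (σ * |t|)) : Continuous (Iz l q) :=
  continuous_iff_continuousAt.2 fun t => (Iz_deriv h hσ hq hb t).continuousAt

theorem Iz_sub {l σ N N' : ℝ} (h : σ < l) (hσ : 0 < σ) {q q' : ℝ → Z} (hq : Continuous q)
    (hb : ∀ t, ‖q t‖ ≤ N * Real.exp (σ * |t|)) (hq' : Continuous q')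
    (hb' : ∀ t, ‖q' t‖ ≤ N' * Real.exp (σ * |t|)) (t : ℝ) :
    Iz l q t - Iz l q' t = Iz l (fun s => q s - q' s) t := by
  unfold Iz
  rw [← smul_sub, ← integral_sub (Iz_int h hσ hq hb t) (Iz_int h hσ hq' hb' t)]
  simp only [smul_sub]

theorem Iz_shift {l : ℝ} (q : ℝ → Z) (t τ : ℝ) :
    Iz l q (t + τ) = Iz l (fun s => q (s + τ)) t := by
  unfold Iz
  have : ∫ s in Set.Iic (t + τ), Real.exp (l * s) • q s =
      ∫ s in Set.Iic t, Real.exp (l * (s + τ)) • q (s + τ) := by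
    rw [← integral_indicator measurableSet_Iic, ← integral_indicator measurableSet_Iic,
      ← integral_add_right_eq_self _ τ]
    congr 1; ext s
    simp [Set.indicator]
  rw [this]
  simp only [mul_add, Real.exp_add, mul_smul]
  rw [← integral_smul, ← integral_smul, ← integral_smul]
  congr 1; ext s
  simp only [smul_smul]
  congr 1
  have : Real.exp (-l * τ) * Real.exp (l * τ) = 1 := by rw [← Real.exp_add]; simp
  linear_combination (Real.exp (-l * t) * Real.exp (l * s)) * this
end
end Slow

namespace Slow
open MeasureTheory
section
variable {E Z : Type*} [NormedAddCommGroup E] [NormedSpace ℝ E] [CompleteSpace E]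
  [NormedAddCommGroup Z] [NormedSpace ℝ Z] [CompleteSpace Z]

theorem one_le_w {σ : ℝ} (hσ : 0 < σ) (t : ℝ) : 1 ≤ Real.exp (σ * |t|) :=
  Real.one_le_exp (by positivity)

theorem pair_bound {l σ N1 N2 : ℝ} (hσ : 0 < σ) (h : σ < l) {e0 : E} {g : ℝ → E} {q : ℝ → Z}
    (hg : Continuous g) (hq : Continuous q)
    (hgb : ∀ s, ‖g s‖ ≤ N1 * Real.exp (σ * |s|))
    (hqb : ∀ s, ‖q s‖ ≤ N2 * Real.exp (σ * |s|)) (t : ℝ) :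
    ‖((e0 + ∫ s in (0:ℝ)..t, g s, Iz l q t) : E × Z)‖ ≤
      max (‖e0‖ + N1 / σ) (N2 / (l - σ)) * Real.exp (σ * |t|) := by
  have h1 := one_le_w hσ t
  have hN1 : 0 ≤ N1 := by have := (norm_nonneg _).trans (hgb 0); simpa using this
  rw [Prod.norm_def]
  apply max_le
  · calc _ ≤ ‖e0‖ + ‖∫ s in (0:ℝ)..t, g s‖ := norm_add_le _ _
      _ ≤ ‖e0‖ + N1 / σ * (Real.exp (σ * |t|) - 1) := by gcongr; exact intw_bound hg hσ hgb t
      _ ≤ (‖e0‖ + N1 / σ) * Real.exp (σ * |t|) := by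
        have : 0 ≤ N1 / σ := by positivity
        nlinarith [norm_nonneg e0]
      _ ≤ _ := by gcongr; exact le_max_left _ _
  · calc _ ≤ _ := Iz_bound h hσ hq hqb t
      _ ≤ _ := by gcongr; exact le_max_right _ _

theorem pair_cont {l σ N2 : ℝ} (hσ : 0 < σ) (h : σ < l) {e0 : E} {g : ℝ → E} {q : ℝ → Z}
    (hg : Continuous g) (hq : Continuous q)
    (hqb : ∀ s, ‖q s‖ ≤ N2 * Real.exp (σ * |s|)) :
    Continuous (fun t => ((e0 + ∫ s in (0:ℝ)..t, g s, Iz l q t) : E × Z)) := by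
  refine Continuous.prodMk (continuous_const.add ?_) (Iz_cont h hσ hq hqb)
  exact intervalIntegral.continuous_primitive (fun a b => hg.intervalIntegrable a b) 0

theorem stab {l σ θ c1 c2 N0 : ℝ} (hσ : 0 < σ) (h : σ < l) (hθ : 0 ≤ θ) (hθ1 : θ < 1)
    (hc1 : 0 ≤ c1) (hc2 : 0 ≤ c2) {d : ℝ → E × Z} {e0 : E} {g : ℝ → E} {q : ℝ → Z}
    (hg : Continuous g) (hq : Continuous q)
    (hd : ∀ t, d t = (e0 + ∫ s in (0:ℝ)..t, g s, Iz l q t))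
    (hgb : ∀ s, ‖g s‖ ≤ θ * σ * ‖d s‖ + c1 * Real.exp (σ * |s|))
    (hqb : ∀ s, ‖q s‖ ≤ θ * (l - σ) * ‖d s‖ + c2 * Real.exp (σ * |s|))
    (hN0 : ∀ t, ‖d t‖ ≤ N0 * Real.exp (σ * |t|)) (t : ℝ) :
    ‖d t‖ ≤ (‖e0‖ + c1 / σ + c2 / (l - σ)) / (1 - θ) * Real.exp (σ * |t|) := by
  have hl : 0 < l - σ := sub_pos.2 h
  have h1θ : 0 < 1 - θ := sub_pos.2 hθ1
  set c := ‖e0‖ + c1 / σ + c2 / (l - σ) with hc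
  have step : ∀ N, (∀ t, ‖d t‖ ≤ N * Real.exp (σ * |t|)) →
      ∀ t, ‖d t‖ ≤ (c + θ * N) * Real.exp (σ * |t|) := by
    intro N hN t
    have hg' : ∀ s, ‖g s‖ ≤ (θ * σ * N + c1) * Real.exp (σ * |s|) := fun s => by
      have := mul_le_mul_of_nonneg_left (hN s) (show 0 ≤ θ * σ by positivity)
      linarith [hgb s]
    have hq' : ∀ s, ‖q s‖ ≤ (θ * (l - σ) * N + c2) * Real.exp (σ * |s|) := fun s => by
      have := mul_le_mul_of_nonneg_left (hN s) (show 0 ≤ θ * (l - σ) by positivity)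
      linarith [hqb s]
    rw [hd t]
    refine (pair_bound hσ h hg hq hg' hq' t).trans ?_
    gcongr
    apply max_le
    · have : (θ * σ * N + c1) / σ = θ * N + c1 / σ := by field_simp
      rw [this]; have : 0 ≤ c2 / (l - σ) := by positivity
      linarith
    · have : (θ * (l - σ) * N + c2) / (l - σ) = θ * N + c2 / (l - σ) := by field_simp
      rw [this]; have : 0 ≤ c1 / σ := by positivity
      linarith [norm_nonneg e0]
  have iter : ∀ k : ℕ, ∀ t, ‖d t‖ ≤ (c / (1 - θ) + θ ^ k * (N0 - c / (1 - θ))) * Real.exp (σ * |t|) := by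
    intro k
    induction k with
    | zero => intro t; simpa using hN0 t
    | succ k ih =>
      intro t
      have := step _ ih t
      convert this using 2
      field_simp; ring
  have lim : Tendsto (fun k : ℕ => (c / (1 - θ) + θ ^ k * (N0 - c / (1 - θ))) * Real.exp (σ * |t|))
      atTop (nhds ((c / (1 - θ) + 0 * (N0 - c / (1 - θ))) * Real.exp (σ * |t|))) :=
    ((((tendsto_pow_atTop_nhds_zero_of_lt_one hθ hθ1).mul_const _).const_add _).mul_const _)
  have := ge_of_tendsto' lim (fun k => iter k t)
  simpa using this

theorem fp {l η θ C : ℝ} (hη : 0 < η) (h : η < l) (hθ : 0 ≤ θ) (hθ1 : θ < 1)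
    {G : ℝ → E × Z → E} {H : ℝ → E × Z → Z}
    (hG : Continuous (Function.uncurry G)) (hH : Continuous (Function.uncurry H))
    (hGl : ∀ t p p', ‖G t p - G t p'‖ ≤ θ * η * ‖p - p'‖)
    (hHl : ∀ t p p', ‖H t p - H t p'‖ ≤ θ * (l - η) * ‖p - p'‖)
    (hG0 : ∀ t, ‖G t 0‖ ≤ C * Real.exp (η * |t|))
    (hH0 : ∀ t, ‖H t 0‖ ≤ C * Real.exp (η * |t|)) (w0 : E) :
    ∃ x : ℝ → E × Z, Continuous x ∧ (∃ N, ∀ t, ‖x t‖ ≤ N * Real.exp (η * |t|)) ∧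
      ∀ t, x t = (w0 + ∫ s in (0:ℝ)..t, G s (x s), Iz l (fun s => H s (x s)) t) := by
  have hl : 0 < l - η := sub_pos.2 h
  let X : BoundedContinuousFunction ℝ (E × Z) → ℝ → E × Z := fun u t => Real.exp (η * |t|) • u t
  have hXc : ∀ u, Continuous (X u) := fun u => by
    have := u.continuous
    show Continuous fun t => Real.exp (η * |t|) • u t
    fun_prop
  have hXb : ∀ u t, ‖X u t‖ ≤ ‖u‖ * Real.exp (η * |t|) := fun u t => by
    show ‖Real.exp (η * |t|) • u t‖ ≤ _
    rw [norm_smul, Real.norm_eq_abs, abs_of_pos (Real.exp_pos _), mul_comm]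
    gcongr; exact u.norm_coe_le_norm t
  have hXd : ∀ u v t, ‖X u t - X v t‖ ≤ dist u v * Real.exp (η * |t|) := fun u v t => by
    show ‖Real.exp (η * |t|) • u t - Real.exp (η * |t|) • v t‖ ≤ _
    rw [← smul_sub, norm_smul, Real.norm_eq_abs, abs_of_pos (Real.exp_pos _), mul_comm, ← dist_eq_norm]
    gcongr; exact BoundedContinuousFunction.dist_coe_le_dist t
  have hgc : ∀ u, Continuous fun s => G s (X u s) := fun u =>
    hG.comp (continuous_id.prodMk (hXc u))
  have hqc : ∀ u, Continuous fun s => H s (X u s) := fun u =>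
    hH.comp (continuous_id.prodMk (hXc u))
  have hgb : ∀ u s, ‖G s (X u s)‖ ≤ (C + θ * η * ‖u‖) * Real.exp (η * |s|) := fun u s => by
    have h1 := hGl s (X u s) 0
    have h2 := norm_le_norm_add_norm_sub' (G s (X u s)) (G s 0)
    have h3 := mul_le_mul_of_nonneg_left (hXb u s) (show 0 ≤ θ * η by positivity)
    rw [sub_zero] at h1
    linarith [hG0 s]
  have hqb : ∀ u s, ‖H s (X u s)‖ ≤ (C + θ * (l - η) * ‖u‖) * Real.exp (η * |s|) := fun u s => by
    have h1 := hHl s (X u s) 0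
    have h2 := norm_le_norm_add_norm_sub' (H s (X u s)) (H s 0)
    have h3 := mul_le_mul_of_nonneg_left (hXb u s) (show 0 ≤ θ * (l - η) by positivity)
    rw [sub_zero] at h1
    linarith [hH0 s]
  let P : BoundedContinuousFunction ℝ (E × Z) → ℝ → E × Z := fun u t =>
    (w0 + ∫ s in (0:ℝ)..t, G s (X u s), Iz l (fun s => H s (X u s)) t)
  have hPc : ∀ u, Continuous (P u) := fun u => pair_cont hη h (hgc u) (hqc u) (hqb u)
  have inv : ∀ t, Real.exp (-(η * |t|)) * Real.exp (η * |t|) = 1 := fun t => by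
    rw [← Real.exp_add]; simp
  have wt : ∀ (t N : ℝ) (y : E × Z), ‖y‖ ≤ N * Real.exp (η * |t|) →
      ‖Real.exp (-(η * |t|)) • y‖ ≤ N := fun t N y hy => by
    rw [norm_smul, Real.norm_eq_abs, abs_of_pos (Real.exp_pos _)]
    calc _ ≤ Real.exp (-(η * |t|)) * (N * Real.exp (η * |t|)) := by gcongr
      _ = N * (Real.exp (-(η * |t|)) * Real.exp (η * |t|)) := by ring
      _ = N := by rw [inv, mul_one]
  let T : BoundedContinuousFunction ℝ (E × Z) → BoundedContinuousFunction ℝ (E × Z) := fun u =>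
    BoundedContinuousFunction.ofNormedAddCommGroup (fun t => Real.exp (-(η * |t|)) • P u t)
      (by have := hPc u; fun_prop) _
      (fun t => wt t _ _ (pair_bound hη h (hgc u) (hqc u) (hgb u) (hqb u) t))
  have hT : ContractingWith ⟨θ, hθ⟩ T := by
    refine ⟨by exact_mod_cast hθ1, LipschitzWith.of_dist_le_mul fun u v => ?_⟩
    show dist (T u) (T v) ≤ θ * dist u v
    rw [BoundedContinuousFunction.dist_le (by positivity)]
    intro t
    rw [dist_eq_norm]
    show ‖Real.exp (-(η * |t|)) • P u t - Real.exp (-(η * |t|)) • P v t‖ ≤ _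
    rw [← smul_sub]
    apply wt
    have e : P u t - P v t = ((0:E) + ∫ s in (0:ℝ)..t, (G s (X u s) - G s (X v s)),
        Iz l (fun s => H s (X u s) - H s (X v s)) t) := by
      rw [← Iz_sub h hη (hqc u) (hqb u) (hqc v) (hqb v),
        intervalIntegral.integral_sub ((hgc u).intervalIntegrable _ _) ((hgc v).intervalIntegrable _ _)]
      show ((_, _) : E × Z) - (_, _) = _
      simp
    rw [e]
    refine (pair_bound (N1 := θ * η * dist u v) (N2 := θ * (l - η) * dist u v) hη h
      ((hgc u).sub (hgc v)) ((hqc u).sub (hqc v)) ?_ ?_ t).trans ?_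
    · intro s
      refine (hGl s _ _).trans ?_
      rw [mul_assoc (θ * η)]; gcongr; exact hXd u v s
    · intro s
      refine (hHl s _ _).trans ?_
      rw [mul_assoc (θ * (l - η))]; gcongr; exact hXd u v s
    · gcongr
      rw [norm_zero, zero_add]
      apply max_le <;> apply le_of_eq <;> field_simp
  obtain ⟨u, hu, -⟩ := hT.exists_fixedPoint 0 (edist_ne_top _ _)
  refine ⟨X u, hXc u, ⟨_, hXb u⟩, fun t => ?_⟩
  have h1 : (T u) t = u t := by rw [hu]
  show Real.exp (η * |t|) • u t = P u t
  rw [← h1]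
  show Real.exp (η * |t|) • Real.exp (-(η * |t|)) • P u t = P u t
  rw [smul_smul, mul_comm, inv, one_smul]
end
end Slow

namespace Slow
open MeasureTheory
section
variable {E Z : Type*} [NormedAddCommGroup E] [NormedSpace ℝ E] [CompleteSpace E]
  [NormedAddCommGroup Z] [NormedSpace ℝ Z] [CompleteSpace Z]

theorem pair_sub {l σ N N' : ℝ} (hσ : 0 < σ) (h : σ < l) {e e' : E} {g g' : ℝ → E} {q q' : ℝ → Z}
    (hg : Continuous g) (hq : Continuous q) (hg' : Continuous g') (hq' : Continuous q')
    (hqb : ∀ s, ‖q s‖ ≤ N * Real.exp (σ * |s|)) (hqb' : ∀ s, ‖q' s‖ ≤ N' * Real.exp (σ * |s|)) 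
    (t : ℝ) :
    ((e + ∫ s in (0:ℝ)..t, g s, Iz l q t) : E × Z) - (e' + ∫ s in (0:ℝ)..t, g' s, Iz l q' t) =
      (e - e' + ∫ s in (0:ℝ)..t, (g s - g' s), Iz l (fun s => q s - q' s) t) := by
  rw [← Iz_sub h hσ hq hqb hq' hqb',
        intervalIntegral.integral_sub (hg.intervalIntegrable _ _) (hg'.intervalIntegrable _ _)]
  rw [Prod.mk_sub_mk]
  congr 1
  abel

theorem quad_contDiff {f : E → Z} {L : E → E →L[ℝ] Z} {C : ℝ} 
    (hq : ∀ w h, ‖f (w + h) - f w - L w h‖ ≤ C * ‖h‖ ^ 2) : ContDiff ℝ 1 f := by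
  have hd : ∀ w, HasFDerivAt f (L w) w := by
    intro w
    rw [hasFDerivAt_iff_isLittleO_nhds_zero]
    have h1 : (fun h => f (w + h) - f w - L w h) =O[nhds 0] fun h => ‖h‖ ^ 2 := by
      apply Asymptotics.IsBigO.of_bound C
      refine Eventually.of_forall fun h => ?_
      simpa using hq w h
    refine h1.trans_isLittleO ?_
    have := Asymptotics.isLittleO_pow_id (𝕜 := ℝ) (n := 2) (by norm_num)
    have h2 := this.comp_tendsto (tendsto_norm_zero (E := E))
    exact (h2.congr_left (fun _ => rfl)).trans_isBigO (Asymptotics.isBigO_norm_left.2 (Asymptotics.isBigO_refl _ _))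
  rw [contDiff_one_iff_fderiv]
  refine ⟨fun w => (hd w).differentiableAt, ?_⟩
  have he : fderiv ℝ f = L := funext fun w => (hd w).fderiv
  rw [he]
  have hC : 0 ≤ |C| := abs_nonneg C
  have hq : ∀ w h, ‖f (w + h) - f w - L w h‖ ≤ |C| * ‖h‖ ^ 2 := fun w h =>
    (hq w h).trans (by gcongr; exact le_abs_self C)
  have hl : LipschitzWith ⟨11 * |C|, by positivity⟩ L := by
    refine LipschitzWith.of_dist_le_mul fun w' w => ?_
    rw [dist_eq_norm, dist_eq_norm]
    show _ ≤ 11 * |C| * _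
    obtain ⟨h, rfl⟩ : ∃ h, w' = w + h := ⟨w' - w, by abel⟩
    rw [add_sub_cancel_left]
    by_cases hh : h = 0
    · simp [hh]
    have hpos : 0 < ‖h‖ := norm_pos_iff.2 hh
    apply ContinuousLinearMap.opNorm_le_of_shell (ε := 2 * ‖h‖) (c := (2:ℝ)) (by positivity) (by positivity)
      (by norm_num)
    intro u hu1 hu2
    have hu1 : ‖h‖ ≤ ‖u‖ := by
      rw [Real.norm_eq_abs, abs_of_pos (by norm_num : (0:ℝ) < 2)] at hu1
      linarith
    have a1 := hq w (h + u)
    have a2 := hq w h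
    have a3 := hq (w + h) u
    have e : (L (w + h) - L w) u = (f (w + (h + u)) - f w - L w (h + u)) - (f (w + h) - f w - L w h)
        - (f (w + h + u) - f (w + h) - L (w + h) u) := by
      rw [← add_assoc, map_add, ContinuousLinearMap.sub_apply]; abel
    rw [e]
    have a4 := norm_sub_le ((f (w + (h + u)) - f w - L w (h + u)) - (f (w + h) - f w - L w h))
      (f (w + h + u) - f (w + h) - L (w + h) u)
    have a5 := norm_sub_le (f (w + (h + u)) - f w - L w (h + u)) (f (w + h) - f w - L w h)
    have a6 : ‖h + u‖ ^ 2 ≤ (2 * ‖u‖) ^ 2 := by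
      gcongr; linarith [norm_add_le h u]
    have a7 : ‖h + u‖ ^ 2 + ‖h‖ ^ 2 + ‖u‖ ^ 2 ≤ 11 * ‖h‖ * ‖u‖ := by nlinarith
    have a8 := mul_le_mul_of_nonneg_left a7 hC
    linarith
  exact hl.continuous

theorem slow_main {l η θ A C M : ℝ} (hη : 0 < η) (h : 2 * η < l) (hθ : 0 ≤ θ) (hθ1 : θ < 1)
    {G : E × ℝ → E} {H : E × ℝ → ℝ}
    (hGl : ∀ p p', ‖G p - G p'‖ ≤ θ * η * ‖p - p'‖)
    (hHl : ∀ p p', ‖H p - H p'‖ ≤ θ * (l - 2 * η) * ‖p - p'‖)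
    (hGb : ∀ p, ‖G p‖ ≤ C) (hHb : ∀ p, ‖H p‖ ≤ l * A)
    {DG : E × ℝ → E × ℝ →L[ℝ] E} {DH : E × ℝ → E × ℝ →L[ℝ] ℝ}
    (hDG : Continuous DG) (hDH : Continuous DH)
    (hDGb : ∀ p : E × ℝ, |p.2| ≤ A → ‖DG p‖ ≤ θ * η)
    (hDHb : ∀ p : E × ℝ, |p.2| ≤ A → ‖DH p‖ ≤ θ * (l - 2 * η))
    (hGq : ∀ p p' : E × ℝ, |p.2| ≤ A → |p'.2| ≤ A → ‖G p' - G p - DG p (p' - p)‖ ≤ M * ‖p' - p‖ ^ 2)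
    (hHq : ∀ p p' : E × ℝ, |p.2| ≤ A → |p'.2| ≤ A → ‖H p' - H p - DH p (p' - p)‖ ≤ M * ‖p' - p‖ ^ 2) :
    ∃ ζ : E → ℝ, ContDiff ℝ 1 ζ ∧ (∀ w, |ζ w| ≤ A) ∧ ∀ w0, ∃ x : ℝ → E × ℝ, x 0 = (w0, ζ w0) ∧
      (∀ t, (x t).2 = ζ (x t).1) ∧ ∀ t, HasDerivAt x (G (x t), -l * (x t).2 + H (x t)) t := by
  have hl : 0 < l - η := by linarith
  have hηl : η < l := by linarith
  have h1θ : 0 < 1 - θ := sub_pos.2 hθ1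
  have hC : 0 ≤ C := (norm_nonneg _).trans (hGb 0)
  have hlA : 0 ≤ l * A := (norm_nonneg _).trans (hHb 0)
  have hM : 0 ≤ |M| := abs_nonneg M
  have hGc : Continuous G := (LipschitzWith.of_dist_le_mul (K := ⟨θ * η, by positivity⟩)
    fun p p' => by rw [dist_eq_norm, dist_eq_norm]; exact hGl p p').continuous
  have hHc : Continuous H := (LipschitzWith.of_dist_le_mul (K := ⟨θ * (l - 2 * η),
      mul_nonneg hθ (by linarith)⟩)
    fun p p' => by rw [dist_eq_norm, dist_eq_norm]; exact hHl p p').continuous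
  have hHl' : ∀ p p', ‖H p - H p'‖ ≤ θ * (l - η) * ‖p - p'‖ := fun p p' =>
    (hHl p p').trans (by gcongr; linarith)
  have hHw : ∀ (x : ℝ → E × ℝ) t, ‖H (x t)‖ ≤ (l * A) * Real.exp (η * |t|) := fun x t =>
    (hHb _).trans (le_mul_of_one_le_right hlA (one_le_w hη t))
  have ex : ∀ w0 : E, ∃ x : ℝ → E × ℝ, Continuous x ∧ (∃ N, ∀ t, ‖x t‖ ≤ N * Real.exp (η * |t|)) ∧
      ∀ t, x t = (w0 + ∫ s in (0:ℝ)..t, G (x s), Iz l (fun s => H (x s)) t) := by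
    intro w0
    refine fp (C := C + l * A) (G := fun _ => G) (H := fun _ => H) hη hηl hθ hθ1
      (hGc.comp continuous_snd) (hHc.comp continuous_snd) (fun _ => hGl) (fun _ => hHl') ?_ ?_ w0
    · intro t
      refine (hGb 0).trans ((le_add_of_nonneg_right hlA).trans 
        (le_mul_of_one_le_right (by positivity) (one_le_w hη t)))
    · intro t
      refine (hHb 0).trans ((le_add_of_nonneg_left hC).trans 
        (le_mul_of_one_le_right (by positivity) (one_le_w hη t)))
  choose x hxc hxN hx using ex
  have hx2 : ∀ w t, |(x w t).2| ≤ A := by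
    intro w t
    rw [hx w t]
    have := Iz_bound0 (N := l * A) (by linarith : 0 < l) (fun s => hHb (x w s)) t
    rwa [mul_div_cancel_left₀ _ (by linarith : l ≠ 0)] at this
  have hx0 : ∀ w, (x w 0).1 = w := by
    intro w; rw [hx w 0]; simp
  -- Lipschitz / uniqueness
  have lip : ∀ (w w' : E) (y y' : ℝ → E × ℝ), Continuous y → Continuous y' → 
      (∃ N, ∀ t, ‖y t‖ ≤ N * Real.exp (η * |t|)) → (∃ N, ∀ t, ‖y' t‖ ≤ N * Real.exp (η * |t|)) →
      (∀ t, y t = (w + ∫ s in (0:ℝ)..t, G (y s), Iz l (fun s => H (y s)) t)) →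
      (∀ t, y' t = (w' + ∫ s in (0:ℝ)..t, G (y' s), Iz l (fun s => H (y' s)) t)) →
      ∀ t, ‖y t - y' t‖ ≤ ‖w - w'‖ / (1 - θ) * Real.exp (η * |t|) := by
    rintro w w' y y' hyc hyc' ⟨N, hN⟩ ⟨N', hN'⟩ hy hy' t
    have hd : ∀ t, y t - y' t = (w - w' + ∫ s in (0:ℝ)..t, (G (y s) - G (y' s)),
        Iz l (fun s => H (y s) - H (y' s)) t) := by
      intro t
      have := pair_sub (e := w) (e' := w') hη hηl (hGc.comp hyc) (hHc.comp hyc) (hGc.comp hyc') (hHc.comp hyc')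
        (hHw y) (hHw y') t
      rw [hy t, hy' t]
      exact this
    have := stab (d := fun t => y t - y' t) (N0 := N + N') (c1 := 0) (c2 := 0) hη hηl hθ hθ1 le_rfl le_rfl
      ((hGc.comp hyc).sub (hGc.comp hyc')) ((hHc.comp hyc).sub (hHc.comp hyc')) hd
      (fun s => by simpa using hGl (y s) (y' s)) (fun s => by simpa using hHl' (y s) (y' s))
      (fun t => by
        have := norm_sub_le (y t) (y' t)
        linarith [hN t, hN' t]) t
    simpa using this
  -- derivative
  have der : ∀ w : E, ∃ L : E →L[ℝ] ℝ, ∀ v, ‖(x (w + v) 0).2 - (x w 0).2 - L v‖ ≤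
      ((|M| / (1 - θ) ^ 2) / (2 * η) + (|M| / (1 - θ) ^ 2) / (l - 2 * η)) / (1 - θ) * ‖v‖ ^ 2 := by
    intro w
    have hDGx : Continuous fun t => DG (x w t) := hDG.comp (hxc w)
    have hDHx : Continuous fun t => DH (x w t) := hDH.comp (hxc w)
    have hpr : ∀ Y : (E →L[ℝ] E) × (E →L[ℝ] ℝ), ‖Y.1.prod Y.2‖ ≤ ‖Y‖ := fun Y =>
      (ContinuousLinearMap.opNorm_prod Y.1 Y.2).le
    have hprc : Continuous fun Y : (E →L[ℝ] E) × (E →L[ℝ] ℝ) => Y.1.prod Y.2 :=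
      (ContinuousLinearMap.prodₗᵢ ℝ (E := E) (F := E) (G := ℝ) (𝕜 := ℝ)).continuous
    have hz0 : ContinuousLinearMap.prod (0 : E →L[ℝ] E) (0 : E →L[ℝ] ℝ) = 0 := by ext <;> simp
    obtain ⟨Y, hYc, ⟨N, hYN⟩, hY⟩ := fp (E := E →L[ℝ] E) (Z := E →L[ℝ] ℝ) (C := 0)
      (G := fun t Y => (DG (x w t)).comp (Y.1.prod Y.2)) (H := fun t Y => (DH (x w t)).comp (Y.1.prod Y.2))
      hη hηl hθ hθ1
      ((hDGx.comp continuous_fst).clm_comp (hprc.comp continuous_snd))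
      ((hDHx.comp continuous_fst).clm_comp (hprc.comp continuous_snd))
      (by
        intro t p p'
        rw [← ContinuousLinearMap.comp_sub]
        refine (ContinuousLinearMap.opNorm_comp_le _ _).trans ?_
        gcongr
        · exact hDGb _ (hx2 w t)
        · exact hpr (p - p'))
      (by
        intro t p p'
        rw [← ContinuousLinearMap.comp_sub]
        refine (ContinuousLinearMap.opNorm_comp_le _ _).trans ?_
        gcongr
        · refine (hDHb _ (hx2 w t)).trans ?_
          gcongr; linarith
        · exact hpr (p - p'))
      (by intro t; simp [hz0]) (by intro t; simp [hz0]) (ContinuousLinearMap.id ℝ E)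
    refine ⟨(Y 0).2, fun v => ?_⟩
    set y : ℝ → E × ℝ := fun t => ((Y t).1 v, (Y t).2 v) with hydef
    have hyc : Continuous y := by
      have h1 : Continuous fun t => (Y t).1 := continuous_fst.comp hYc
      have h2 : Continuous fun t => (Y t).2 := continuous_snd.comp hYc
      exact (h1.clm_apply continuous_const).prodMk (h2.clm_apply continuous_const)
    have hN0 : 0 ≤ N := by have := (norm_nonneg _).trans (hYN 0); simpa using this
    have hyN : ∀ t, ‖y t‖ ≤ N * ‖v‖ * Real.exp (η * |t|) := by
      intro t
      have h1 : ‖y t‖ ≤ ‖(Y t).1.prod (Y t).2‖ * ‖v‖ := ((Y t).1.prod (Y t).2).le_opNorm v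
      have h2 := mul_le_mul_of_nonneg_right ((hpr (Y t)).trans (hYN t)) (norm_nonneg v)
      linarith
    have hcG : Continuous fun s => (DG (x w s)).comp ((Y s).1.prod (Y s).2) :=
      hDGx.clm_comp (hprc.comp hYc)
    have hcH : Continuous fun s => (DH (x w s)).comp ((Y s).1.prod (Y s).2) :=
      hDHx.clm_comp (hprc.comp hYc)
    have hbH : ∀ s, ‖(DH (x w s)).comp ((Y s).1.prod (Y s).2)‖ ≤
        (θ * (l - 2 * η) * N) * Real.exp (η * |s|) := by
      intro s
      refine (ContinuousLinearMap.opNorm_comp_le _ _).trans ?_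
      rw [mul_assoc (θ * (l - 2 * η))]
      have h0 : 0 ≤ l - 2 * η := by linarith
      gcongr
      · exact hDHb _ (hx2 w s)
      · exact (hpr (Y s)).trans (hYN s)
    have hy : ∀ t, y t = (v + ∫ s in (0:ℝ)..t, DG (x w s) (y s), Iz l (fun s => DH (x w s) (y s)) t) := by
      intro t
      have e1 : (Y t).1 = ContinuousLinearMap.id ℝ E +
          ∫ s in (0:ℝ)..t, (DG (x w s)).comp ((Y s).1.prod (Y s).2) := by rw [hY t]
      have e2 : (Y t).2 = Iz l (fun s => (DH (x w s)).comp ((Y s).1.prod (Y s).2)) t := by rw [hY t]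
      refine Prod.ext ?_ ?_
      · show (Y t).1 v = _
        rw [e1, ContinuousLinearMap.add_apply,
          ContinuousLinearMap.intervalIntegral_apply (hcG.intervalIntegrable _ _)]
        rfl
      · show (Y t).2 v = _
        rw [e2]
        unfold Iz
        rw [ContinuousLinearMap.smul_apply, ContinuousLinearMap.integral_apply (Iz_int hηl hη hcH hbH t)]
        rfl
    have hgy : Continuous fun s => DG (x w s) (y s) := hDGx.clm_apply hyc
    have hqy : Continuous fun s => DH (x w s) (y s) := hDHx.clm_apply hyc
    have hqyb : ∀ s, ‖DH (x w s) (y s)‖ ≤ (θ * (l - 2 * η) * N) * ‖v‖ * Real.exp (η * |s|) := by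
      intro s
      have h1 : ‖DH (x w s) (y s)‖ ≤ ‖(DH (x w s)).comp ((Y s).1.prod (Y s).2)‖ * ‖v‖ :=
        ((DH (x w s)).comp ((Y s).1.prod (Y s).2)).le_opNorm v
      have h2 := mul_le_mul_of_nonneg_right (hbH s) (norm_nonneg v)
      linarith
    have hgx : ∀ w, Continuous fun s => G (x w s) := fun w => hGc.comp (hxc w)
    have hqx : ∀ w, Continuous fun s => H (x w s) := fun w => hHc.comp (hxc w)
    have hlip : ∀ t, ‖x (w + v) t - x w t‖ ≤ ‖v‖ / (1 - θ) * Real.exp (η * |t|) := by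
      intro t
      have := lip (w + v) w _ _ (hxc _) (hxc _) (hxN _) (hxN _) (hx _) (hx _) t
      rwa [add_sub_cancel_left] at this
    have hlip2 : ∀ t, |M| * ‖x (w + v) t - x w t‖ ^ 2 ≤
        |M| / (1 - θ) ^ 2 * ‖v‖ ^ 2 * Real.exp (2 * η * |t|) := by
      intro t
      have e : Real.exp (2 * η * |t|) = Real.exp (η * |t|) ^ 2 := by
        rw [← Real.exp_nat_mul]; push_cast; ring_nf
      rw [e]
      calc _ ≤ |M| * (‖v‖ / (1 - θ) * Real.exp (η * |t|)) ^ 2 := by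
            gcongr; exact hlip t
        _ = _ := by rw [mul_pow, div_pow]; ring
    have hd : ∀ t, x (w + v) t - x w t - y t = (0 + ∫ s in (0:ℝ)..t,
        (G (x (w + v) s) - G (x w s) - DG (x w s) (y s)),
        Iz l (fun s => H (x (w + v) s) - H (x w s) - DH (x w s) (y s)) t) := by
      intro t
      have e1 := pair_sub (e := w + v) (e' := w) hη hηl (hgx (w + v)) (hqx (w + v)) (hgx w) (hqx w)
        (hHw (x (w + v))) (hHw (x w)) t
      rw [← hx, ← hx] at e1
      have e2 := pair_sub (e := w + v - w) (e' := v) (N := l * A + l * A)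
        (g := fun s => G (x (w + v) s) - G (x w s)) (q := fun s => H (x (w + v) s) - H (x w s)) hη hηl
        ((hgx (w + v)).sub (hgx w)) ((hqx (w + v)).sub (hqx w)) hgy hqy
        (fun s => by
          have := norm_sub_le (H (x (w + v) s)) (H (x w s))
          linarith [hHw (x (w + v)) s, hHw (x w) s]) hqyb t
      rw [← e1, ← hy] at e2
      rw [e2]
      congr 2
      abel
    have hee : ∀ t, Real.exp (η * |t|) ≤ Real.exp (2 * η * |t|) := fun t => by
      apply Real.exp_le_exp.2
      nlinarith [abs_nonneg t, mul_nonneg hη.le (abs_nonneg t)]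
    have hfin := stab (d := fun t => x (w + v) t - x w t - y t) (σ := 2 * η) (θ := θ) 
      (c1 := |M| / (1 - θ) ^ 2 * ‖v‖ ^ 2) (c2 := |M| / (1 - θ) ^ 2 * ‖v‖ ^ 2) 
      (N0 := ‖v‖ / (1 - θ) + N * ‖v‖) (by linarith) h hθ hθ1 (by positivity) (by positivity)
      (((hgx (w + v)).sub (hgx w)).sub hgy) (((hqx (w + v)).sub (hqx w)).sub hqy) hd
      (by
        intro s
        have e : G (x (w + v) s) - G (x w s) - DG (x w s) (y s) =
          DG (x w s) (x (w + v) s - x w s - y s) +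
          (G (x (w + v) s) - G (x w s) - DG (x w s) (x (w + v) s - x w s)) := by
          rw [map_sub (DG (x w s)) _ (y s)]; abel
        show ‖G (x (w + v) s) - G (x w s) - DG (x w s) (y s)‖ ≤ _
        rw [e]
        refine (norm_add_le _ _).trans (add_le_add ?_ ?_)
        · refine (ContinuousLinearMap.le_opNorm _ _).trans ?_
          gcongr
          refine (hDGb _ (hx2 w s)).trans ?_
          nlinarith
        · refine (hGq _ _ (hx2 w s) (hx2 _ s)).trans (le_trans ?_ (hlip2 s))
          gcongr; exact le_abs_self M)
      (by
        intro s
        have e : H (x (w + v) s) - H (x w s) - DH (x w s) (y s) =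
          DH (x w s) (x (w + v) s - x w s - y s) +
          (H (x (w + v) s) - H (x w s) - DH (x w s) (x (w + v) s - x w s)) := by
          rw [map_sub (DH (x w s)) _ (y s)]; abel
        show ‖H (x (w + v) s) - H (x w s) - DH (x w s) (y s)‖ ≤ _
        rw [e]
        refine (norm_add_le _ _).trans (add_le_add ?_ ?_)
        · refine (ContinuousLinearMap.le_opNorm _ _).trans ?_
          gcongr
          exact hDHb _ (hx2 w s)
        · refine (hHq _ _ (hx2 w s) (hx2 _ s)).trans (le_trans ?_ (hlip2 s))
          gcongr; exact le_abs_self M)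
      (by
        intro t
        have h1 := norm_sub_le (x (w + v) t - x w t) (y t)
        have h2 := mul_le_mul_of_nonneg_left (hee t) (show 0 ≤ ‖v‖ / (1 - θ) + N * ‖v‖ by positivity)
        show ‖x (w + v) t - x w t - y t‖ ≤ _
        linarith [hlip t, hyN t]) 0
    have h3 : ‖(x (w + v) 0).2 - (x w 0).2 - (Y 0).2 v‖ ≤ ‖x (w + v) 0 - x w 0 - y 0‖ :=
      norm_snd_le (x (w + v) 0 - x w 0 - y 0)
    refine h3.trans (hfin.trans (le_of_eq ?_))
    simp
    ring
  choose L hL using der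
  refine ⟨fun w => (x w 0).2, quad_contDiff hL, fun w => hx2 w 0, fun w => ⟨x w, ?_, ?_, ?_⟩⟩
  · exact Prod.ext (hx0 w) rfl
  · intro τ
    have hs := lip (x w τ).1 (x w τ).1 (fun t => x w (t + τ)) (x (x w τ).1) 
      ((hxc w).comp (continuous_add_const τ)) (hxc _) ?_ (hxN _) ?_ (hx _) 0
    · simp only [sub_self, norm_zero, zero_div, zero_mul, zero_add] at hs
      have := sub_eq_zero.1 (norm_le_zero_iff.1 hs)
      exact congrArg Prod.snd this
    · obtain ⟨N, hN⟩ := hxN w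
      have hN0 : 0 ≤ N := by have := (norm_nonneg _).trans (hN 0); simpa using this
      refine ⟨N * Real.exp (η * |τ|), fun t => (hN _).trans ?_⟩
      rw [mul_assoc, ← Real.exp_add]
      gcongr
      have := abs_add_le t τ
      nlinarith
    · intro t
      have e1 := hx w (t + τ)
      have e2 := hx w τ
      rw [Iz_shift] at e1
      rw [e1]
      refine Prod.ext ?_ rfl
      show w + _ = _ + _
      rw [e2]
      show _ = (w + ∫ s in (0:ℝ)..τ, G (x w s)) + _
      rw [intervalIntegral.integral_comp_add_right (fun s => G (x w s)) τ, zero_add, add_assoc,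
        intervalIntegral.integral_add_adjacent_intervals]
      · exact (hGc.comp (hxc w)).intervalIntegrable _ _
      · exact (hGc.comp (hxc w)).intervalIntegrable _ _
  · intro t
    have hg : Continuous fun s => G (x w s) := hGc.comp (hxc w)
    have d1 := (intervalIntegral.integral_hasDerivAt_right (hg.intervalIntegrable 0 t)
      hg.aestronglyMeasurable.stronglyMeasurableAtFilter hg.continuousAt).const_add w
    have d2 := Iz_deriv hηl hη (hHc.comp (hxc w)) (hHw (x w)) t
    have d3 := d1.prodMk d2
    have e : x w = fun t => (w + ∫ s in (0:ℝ)..t, G (x w s), Iz l (fun s => H (x w s)) t) :=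
      funext (hx w)
    have e2 : (x w t).2 = Iz l (fun s => H (x w s)) t := by rw [hx w t]
    rw [e2]
    nth_rewrite 1 [e]
    exact d3
end
end Slow

namespace Slow
open MeasureTheory
section
variable {E Z : Type*} [NormedAddCommGroup E] [NormedSpace ℝ E] [CompleteSpace E]
  [NormedAddCommGroup Z] [NormedSpace ℝ Z] [CompleteSpace Z]

theorem quad_of_compact {R : E → Z} (hR : ContDiff ℝ 2 R) (hc : HasCompactSupport R) (L : E →L[ℝ] Z) :
    ∃ M, ∀ p p', ‖(L p' + R p') - (L p + R p) - fderiv ℝ (fun p => L p + R p) p (p' - p)‖ ≤ M * ‖p' - p‖ ^ 2 := by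
  have h1 : ContDiff ℝ 1 (fderiv ℝ R) := hR.fderiv_right (by norm_num)
  obtain ⟨M, hM⟩ := h1.lipschitzWith_of_hasCompactSupport (hc.fderiv (𝕜 := ℝ)) (by norm_num)
  have hd : Differentiable ℝ R := hR.differentiable (by norm_num)
  refine ⟨M, fun p p' => ?_⟩
  have e : fderiv ℝ (fun p => L p + R p) p = L + fderiv ℝ R p := by
    rw [fderiv_fun_add L.differentiableAt (hd p)]; simp
  have e2 : (L p' + R p') - (L p + R p) - fderiv ℝ (fun p => L p + R p) p (p' - p)
      = R p' - R p - fderiv ℝ R p (p' - p) := by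
    rw [e]; simp; abel
  rw [e2]
  have := (convex_closedBall p ‖p' - p‖).norm_image_sub_le_of_norm_fderiv_le' (𝕜 := ℝ) (f := R)
    (φ := fderiv ℝ R p) (C := M * ‖p' - p‖) (x := p) (y := p')
    (fun x _ => hd x) (fun x hx => ?_) (by simp) (by simp [dist_eq_norm])
  · calc _ ≤ _ := this
      _ = _ := by ring
  · rw [mem_closedBall_iff_norm] at hx
    have := hM.dist_le_mul x p
    rw [dist_eq_norm, dist_eq_norm] at this
    exact this.trans (by gcongr)

def cl (A z : ℝ) : ℝ := max (-A) (min z A)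

theorem cl_abs {A : ℝ} (hA : 0 ≤ A) (z : ℝ) : |cl A z| ≤ A := by
  unfold cl; rw [abs_le]; constructor
  · exact le_max_left _ _
  · exact max_le (by linarith) (min_le_right _ _)

theorem cl_eq {A z : ℝ} (h : |z| ≤ A) : cl A z = z := by
  rw [abs_le] at h
  unfold cl; rw [min_eq_left h.2, max_eq_right h.1]

theorem cl_lip (A z z' : ℝ) : |cl A z - cl A z'| ≤ |z - z'| := by
  unfold cl
  have h1 := abs_max_sub_max_le_max (-A) (min z A) (-A) (min z' A)
  have h2 := abs_min_sub_min_le_max z A z' A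
  simp at h1 h2
  exact h1.trans h2

def clp (A : ℝ) (p : E × ℝ) : E × ℝ := (p.1, cl A p.2)

theorem clp_lip (A : ℝ) (p p' : E × ℝ) : ‖clp A p - clp A p'‖ ≤ ‖p - p'‖ := by
  rw [Prod.norm_def, Prod.norm_def]
  exact max_le_max le_rfl (cl_lip _ _ _)

theorem fderiv_le {A A' c : ℝ} (hA : A' < A) (hc : 0 ≤ c) {f : E × ℝ → Z} (hf : Differentiable ℝ f)
    (hl : ∀ p p', |p.2| ≤ A → |p'.2| ≤ A → ‖f p - f p'‖ ≤ c * ‖p - p'‖) (p : E × ℝ) (hp : |p.2| ≤ A') :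
    ‖fderiv ℝ f p‖ ≤ c := by
  lift c to NNReal using hc
  apply (hf p).hasFDerivAt.le_of_lipschitzOn (s := {p | |p.2| ≤ A})
  · have : ContinuousAt (fun p : E × ℝ => |p.2|) p := by fun_prop
    exact (this.eventually_lt_const (lt_of_le_of_lt hp hA)).mono fun _ h => h.le
  · exact LipschitzOnWith.of_dist_le_mul fun x hx y hy => by
      rw [dist_eq_norm, dist_eq_norm]; exact hl _ _ hx hy

theorem slow_clamp {l η θ A A' C : ℝ} (hη : 0 < η) (h : 2 * η < l) (hθ : 0 ≤ θ) (hθ1 : θ < 1)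
    (hA0 : 0 ≤ A') (hA : A' < A)
    {LG : E × ℝ →L[ℝ] E} {RG : E × ℝ → E} {LH : E × ℝ →L[ℝ] ℝ} {RH : E × ℝ → ℝ}
    (hRG : ContDiff ℝ 2 RG) (hRGc : HasCompactSupport RG)
    (hRH : ContDiff ℝ 2 RH) (hRHc : HasCompactSupport RH)
    (hGl : ∀ p p', |p.2| ≤ A → |p'.2| ≤ A → ‖(LG p + RG p) - (LG p' + RG p')‖ ≤ θ * η * ‖p - p'‖)
    (hHl : ∀ p p', |p.2| ≤ A → |p'.2| ≤ A → ‖(LH p + RH p) - (LH p' + RH p')‖ ≤ θ * (l - 2 * η) * ‖p - p'‖)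
    (hGb : ∀ p, |p.2| ≤ A → ‖LG p + RG p‖ ≤ C) (hHb : ∀ p, |p.2| ≤ A → ‖LH p + RH p‖ ≤ l * A') :
    ∃ ζ : E → ℝ, ContDiff ℝ 1 ζ ∧ (∀ w, |ζ w| ≤ A') ∧ ∀ t₀ t₁ : ℝ, ∀ y : ℝ → E × ℝ, 
      ContinuousOn y (Icc t₀ t₁) →
      (∀ t ∈ Icc t₀ t₁, |(y t).2| ≤ A → 
        HasDerivAt y (LG (y t) + RG (y t), -l * (y t).2 + (LH (y t) + RH (y t))) t) →
      (y t₀).2 = ζ (y t₀).1 → ∀ t ∈ Icc t₀ t₁, (y t).2 = ζ (y t).1 := by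
  have hA' : 0 ≤ A := hA0.trans hA.le
  obtain ⟨M1, hM1⟩ := quad_of_compact hRG hRGc LG
  obtain ⟨M2, hM2⟩ := quad_of_compact hRH hRHc LH
  have hdG : ContDiff ℝ 2 (fun p => LG p + RG p) := LG.contDiff.add hRG
  have hdH : ContDiff ℝ 2 (fun p => LH p + RH p) := LH.contDiff.add hRH
  have hcl : ∀ p : E × ℝ, |(clp A p).2| ≤ A := fun p => cl_abs hA' _
  have hce : ∀ p : E × ℝ, |p.2| ≤ A → clp A p = p := fun p hp => by
    unfold clp; rw [cl_eq hp]
  have hl : 0 ≤ l - 2 * η := by linarith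
  obtain ⟨ζ, hζ, hζb, hx⟩ := slow_main (A := A') (C := C) (M := max M1 M2) hη h hθ hθ1
    (G := fun p => LG (clp A p) + RG (clp A p)) (H := fun p => LH (clp A p) + RH (clp A p))
    (DG := fderiv ℝ (fun p => LG p + RG p)) (DH := fderiv ℝ (fun p => LH p + RH p))
    (fun p p' => (hGl _ _ (hcl p) (hcl p')).trans (by gcongr; exact clp_lip _ _ _))
    (fun p p' => (hHl _ _ (hcl p) (hcl p')).trans (by gcongr; exact clp_lip _ _ _))
    (fun p => hGb _ (hcl p)) (fun p => hHb _ (hcl p))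
    (hdG.continuous_fderiv (by norm_num)) (hdH.continuous_fderiv (by norm_num))
    (fun p hp => fderiv_le hA (by positivity) (hdG.differentiable (by norm_num)) hGl p hp)
    (fun p hp => fderiv_le hA (by positivity) (hdH.differentiable (by norm_num)) hHl p hp)
    (fun p p' hp hp' => by
      simp only [hce p (hp.trans hA.le), hce p' (hp'.trans hA.le)]
      exact (hM1 p p').trans (by gcongr; exact le_max_left _ _))
    (fun p p' hp hp' => by
      simp only [hce p (hp.trans hA.le), hce p' (hp'.trans hA.le)]
      exact (hM2 p p').trans (by gcongr; exact le_max_right _ _))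
  refine ⟨ζ, hζ, hζb, fun t₀ t₁ y hyc hy hy0 => ?_⟩
  obtain ⟨x, hx0, hxz, hxd⟩ := hx (y t₀).1
  have hxc : Continuous x := continuous_iff_continuousAt.2 fun t => (hxd t).continuousAt
  set X : ℝ → E × ℝ := fun t => x (t - t₀) with hX
  have hXc : Continuous X := by fun_prop
  have hXd : ∀ t, HasDerivAt X (LG (clp A (X t)) + RG (clp A (X t)), -l * (X t).2 + (LH (clp A (X t)) + RH (clp A (X t)))) t := by
    intro t
    exact (hxd (t - t₀)).comp_sub_const t t₀
  have hXz : ∀ t, (X t).2 = ζ (X t).1 := fun t => hxz _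
  have key : Icc t₀ t₁ ⊆ {t | y t = X t} := by
    apply IsClosed.Icc_subset_of_forall_exists_gt
    · have := (hyc.sub hXc.continuousOn).preimage_isClosed_of_isClosed isClosed_Icc (isClosed_singleton (x := (0 : E × ℝ)))
      convert this using 1
      ext t
      simp [and_comm, sub_eq_zero]
    · simp only [mem_setOf_eq, hX, sub_self, hx0]
      exact Prod.ext rfl hy0
    · rintro t ⟨ht, ht1⟩ s hs
      have ht : y t = X t := ht
      have hyt : |(y t).2| < A := by
        rw [ht, hXz]; exact lt_of_le_of_lt (hζb _) hA
      have hca : ContinuousAt y t := (hy t ⟨ht1.1, ht1.2.le⟩ hyt.le).continuousAt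
      have hca2 : ContinuousAt (fun t => |(y t).2|) t := by fun_prop
      obtain ⟨δ, hδ, hδ2⟩ := Metric.eventually_nhds_iff.1 (hca2.eventually_lt_const hyt)
      have hts : t < s := hs
      set u := min (min s t₁) (t + δ / 2) with hu
      have hu1 : t < u := lt_min (lt_min hts ht1.2) (by linarith)
      have hu2 : u ≤ s := (min_le_left _ _).trans (min_le_left _ _)
      have hu3 : u ≤ t₁ := (min_le_left _ _).trans (min_le_right _ _)
      have hu4 : u ≤ t + δ / 2 := min_le_right _ _
      have hnear : ∀ r ∈ Icc t u, |(y r).2| ≤ A := by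
        intro r hr
        apply le_of_lt; apply hδ2
        rw [Real.dist_eq, abs_of_nonneg (by linarith [hr.1])]
        linarith [hr.2]
      have hsub : Icc t u ⊆ Icc t₀ t₁ := Icc_subset_Icc ht1.1 hu3
      set F : E × ℝ → E × ℝ := fun p => (LG (clp A p) + RG (clp A p), -l * p.2 + (LH (clp A p) + RH (clp A p))) with hF
      have hFl : LipschitzWith (Real.toNNReal (θ * η + (l + θ * (l - 2 * η)))) F := by
        apply LipschitzWith.of_dist_le_mul
        intro p p'
        rw [Real.coe_toNNReal _ (by have : 0 < l := by linarith
                                    positivity), dist_eq_norm, dist_eq_norm]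
        have h1 := (hGl _ _ (hcl p) (hcl p')).trans (mul_le_mul_of_nonneg_left (clp_lip A p p') (by positivity))
        have h2 := (hHl _ _ (hcl p) (hcl p')).trans (mul_le_mul_of_nonneg_left (clp_lip A p p') (by positivity))
        have h3 : ‖p.2 - p'.2‖ ≤ ‖p - p'‖ := norm_snd_le (p - p')
        have hn := norm_nonneg (p - p')
        have hl0 : 0 ≤ l := by linarith
        rw [Prod.norm_def]
        apply max_le
        · refine h1.trans ?_
          gcongr
          have : 0 ≤ l + θ * (l - 2 * η) := by positivity
          linarith
        · have e : (F p - F p').2 = -l * (p.2 - p'.2) + ((LH (clp A p) + RH (clp A p)) - (LH (clp A p') + RH (clp A p'))) := by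
            simp only [hF, Prod.snd_sub]; ring
          rw [e]
          calc _ ≤ ‖-l * (p.2 - p'.2)‖ + _ := norm_add_le _ _
            _ ≤ l * ‖p - p'‖ + θ * (l - 2 * η) * ‖p - p'‖ := by
              apply add_le_add _ h2
              rw [norm_mul, norm_neg, Real.norm_of_nonneg hl0]
              gcongr
            _ ≤ _ := by
              have : 0 ≤ θ * η * ‖p - p'‖ := by positivity
              nlinarith
      have := ODE_solution_unique_of_mem_Icc_right (v := fun _ => F) (s := fun _ => univ) (f := y) (g := X)
        (a := t) (b := u) (fun _ _ => hFl.lipschitzOnWith) (hyc.mono hsub)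
        (fun r hr => by
          have := hy r (hsub ⟨hr.1, hr.2.le⟩) (hnear r ⟨hr.1, hr.2.le⟩)
          simp only [hF]
          rw [hce _ (hnear r ⟨hr.1, hr.2.le⟩)]
          exact this.hasDerivWithinAt) (fun _ _ => mem_univ _)
        hXc.continuousOn (fun r hr => (hXd r).hasDerivWithinAt) (fun _ _ => mem_univ _) ht
      exact ⟨u, this ⟨hu1.le, le_rfl⟩, hu1, hu2⟩
  intro t ht
  have := key ht
  simp only [mem_setOf_eq] at this
  rw [this]; exact hXz t
end
end Slow

namespace Slow
open MeasureTheory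
section
variable {E Z : Type*} [NormedAddCommGroup E] [NormedSpace ℝ E] [CompleteSpace E]
  [NormedAddCommGroup Z] [NormedSpace ℝ Z] [CompleteSpace Z]

def sc (κ : ℝ) (p : E × ℝ) : E × ℝ := (p.1, κ * p.2)

theorem sc_contDiff (κ : ℝ) : ContDiff ℝ 2 (sc κ : E × ℝ → E × ℝ) := by
  unfold sc; fun_prop

theorem sc_lip {κ : ℝ} (h0 : 0 ≤ κ) (h1 : κ ≤ 1) (p p' : E × ℝ) : ‖sc κ p - sc κ p'‖ ≤ ‖p - p'‖ := by
  rw [Prod.norm_def, Prod.norm_def]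
  apply max_le_max le_rfl
  simp only [sc, Prod.snd_sub]
  rw [← mul_sub, norm_mul, Real.norm_of_nonneg h0]
  exact mul_le_of_le_one_left (norm_nonneg _) h1

theorem sc_compact {κ : ℝ} (h : κ ≠ 0) {f : E × ℝ → Z} (hf : HasCompactSupport f) : 
    HasCompactSupport (fun p => f (sc κ p)) := 
  hf.comp_homeomorph ((Homeomorph.refl E).prodCongr (Homeomorph.mulLeft₀ κ h))

theorem bl {f : E → Z} (hf : ContDiff ℝ 2 f) (hc : HasCompactSupport f) : 
    ∃ C L : ℝ, 0 ≤ C ∧ 0 ≤ L ∧ (∀ p, ‖f p‖ ≤ C) ∧ ∀ p p', ‖f p - f p'‖ ≤ L * ‖p - p'‖ := by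
  obtain ⟨C, hC⟩ := hc.exists_bound_of_continuous hf.continuous
  obtain ⟨L, hL⟩ := hf.lipschitzWith_of_hasCompactSupport hc (by norm_num)
  refine ⟨C, L, (norm_nonneg _).trans (hC 0), L.2, hC, fun p p' => ?_⟩
  have := hL.dist_le_mul p p'
  rwa [dist_eq_norm, dist_eq_norm] at this

theorem slow_abs {a0 : ℝ} (ha0 : 0 < a0) (e : E) {c b : E × ℝ → ℝ} {k : E × ℝ → E}
    (hc : ContDiff ℝ 2 c) (hcc : HasCompactSupport c) (hc0 : ∀ p, 0 ≤ c p)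
    (hb : ContDiff ℝ 2 b) (hbc : HasCompactSupport b)
    (hk : ContDiff ℝ 2 k) (hkc : HasCompactSupport k) :
    ∃ A > 0, ∃ B > 0, ∃ γ₀ > 0, ∀ γ ∈ Ioo (0:ℝ) γ₀, 
    ∃ ζ : E → ℝ, ContDiff ℝ 1 ζ ∧ (∀ w, |ζ w| ≤ A) ∧ ∀ t₀ t₁ : ℝ, ∀ y : ℝ → E × ℝ, 
      ContinuousOn y (Icc t₀ t₁) →
      (∀ t ∈ Icc t₀ t₁, |(y t).2| ≤ A → 
        HasDerivAt y (γ • ((B * (y t).2) • e + k ((y t).1, γ * B * (y t).2)), 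
          -(a0 + c ((y t).1, γ * B * (y t).2)) * (y t).2 + b ((y t).1, γ * B * (y t).2) / B) t) →
      (y t₀).2 = ζ (y t₀).1 → ∀ t ∈ Icc t₀ t₁, (y t).2 = ζ (y t).1 := by
  obtain ⟨Cc, Lc, hCc0, hLc0, hCc, hLc⟩ := bl hc hcc
  obtain ⟨Cb, Lb, hCb0, hLb0, hCb, hLb⟩ := bl hb hbc
  obtain ⟨Ck, Lk, hCk0, hLk0, hCk, hLk⟩ := bl hk hkc
  obtain ⟨l, hl⟩ : ∃ l, l = a0 + Cc := ⟨_, rfl⟩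
  obtain ⟨θ, hθ⟩ : ∃ θ, θ = (l - a0 / 2) / (l - a0 / 4) := ⟨_, rfl⟩
  obtain ⟨A, hA⟩ : ∃ A, A = a0 / (4 * (Lc + 1)) := ⟨_, rfl⟩
  have hA0 : 0 < A := by rw [hA]; positivity
  obtain ⟨B, hB⟩ : ∃ B, B = 4 * Lb / a0 + 2 * Cb / (a0 * A) + 1 := ⟨_, rfl⟩
  have hB0 : 0 < B := by rw [hB]; positivity
  have hθ0 : 0 < θ := by rw [hθ]; apply div_pos <;> linarith
  have hθ1 : θ < 1 := by rw [hθ, div_lt_one] <;> linarith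
  have hθe : θ * (l - 2 * (a0 / 8)) = Cc + a0 / 2 := by
    have : l - a0 / 4 ≠ 0 := by apply ne_of_gt; linarith
    have e2 : l - 2 * (a0 / 8) = l - a0 / 4 := by ring
    rw [hθ, e2, div_mul_cancel₀ _ this, hl]; ring
  have hLcA : Lc * A ≤ a0 / 4 := by
    rw [hA, mul_div_assoc', div_le_div_iff₀ (by positivity) (by positivity)]
    nlinarith
  have hLbB : Lb / B ≤ a0 / 4 := by
    rw [div_le_iff₀ hB0, hB]
    have : 0 ≤ 2 * Cb / (a0 * A) := by positivity
    have h2 : Lb = a0 / 4 * (4 * Lb / a0) := by field_simp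
    nlinarith
  have hCbB : Cb / B ≤ a0 * A / 2 := by
    rw [div_le_iff₀ hB0, hB]
    have : 0 ≤ 4 * Lb / a0 := by positivity
    have h2 : Cb = a0 * A / 2 * (2 * Cb / (a0 * A)) := by field_simp
    have h3 : 0 < a0 * A := by positivity
    nlinarith
  have hD : 0 < B * ‖e‖ + Lk + 1 := by positivity
  refine ⟨A, hA0, B, hB0, min (1 / B) (θ * (a0 / 8) / (B * ‖e‖ + Lk + 1)), by positivity, ?_⟩
  rintro γ ⟨hγ, hγ1⟩
  have hκ1 : γ * B ≤ 1 := by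
    rw [← le_div_iff₀ hB0]; exact hγ1.le.trans (min_le_left _ _)
  have hγ2 : γ * (B * ‖e‖ + Lk) ≤ θ * (a0 / 8) := by
    have := hγ1.le.trans (min_le_right _ _)
    rw [le_div_iff₀ hD] at this
    linarith
  have hκ : 0 < γ * B := by positivity
  have hl0 : 0 < l := by linarith
  have hA'e : l * (A - a0 * A / (2 * l)) = Cc * A + a0 * A / 2 := by
    have : l * (A - a0 * A / (2 * l)) = l * A - a0 * A / 2 := by field_simp
    rw [this, hl]; ring
  have hA'0 : 0 ≤ A - a0 * A / (2 * l) := by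
    by_contra hn
    push Not at hn
    have : l * (A - a0 * A / (2 * l)) < 0 := by nlinarith
    rw [hA'e] at this
    have : 0 ≤ Cc * A + a0 * A / 2 := by positivity
    linarith
  have hA'A : A - a0 * A / (2 * l) < A := by
    have : 0 < a0 * A / (2 * l) := by positivity
    linarith
  obtain ⟨ζ, hζ, hζb, H⟩ := slow_clamp (l := l) (η := a0 / 8) (θ := θ) (A := A) 
    (A' := A - a0 * A / (2 * l)) (C := γ * (B * A * ‖e‖ + Ck)) (by positivity) (by linarith) hθ0.le hθ1
    hA'0 hA'A (LG := (γ * B) • (ContinuousLinearMap.toSpanSingleton ℝ e ∘L ContinuousLinearMap.snd ℝ E ℝ))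
    (RG := fun p => γ • k (sc (γ * B) p)) (LH := Cc • ContinuousLinearMap.snd ℝ E ℝ)
    (RH := fun p => - c (sc (γ * B) p) * p.2 + b (sc (γ * B) p) / B)
    (by have := hk.comp (sc_contDiff (E := E) (γ * B)); exact this.const_smul γ)
    ((sc_compact hκ.ne' hkc).smul_left (f := fun _ => γ))
    (by have h1 := hc.comp (sc_contDiff (E := E) (γ * B))
        have h2 := hb.comp (sc_contDiff (E := E) (γ * B))
        exact (h1.neg.mul contDiff_snd).add (h2.div_const B))
    (((sc_compact hκ.ne' hcc).neg.mul_right).add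
      (by simp_rw [div_eq_mul_inv]; exact (sc_compact hκ.ne' hbc).mul_right))
    (fun p p' hp hp' => by
      have e1 : (((γ * B) • (ContinuousLinearMap.toSpanSingleton ℝ e ∘L ContinuousLinearMap.snd ℝ E ℝ)) p + γ • k (sc (γ * B) p)) - (((γ * B) • (ContinuousLinearMap.toSpanSingleton ℝ e ∘L ContinuousLinearMap.snd ℝ E ℝ)) p' + γ • k (sc (γ * B) p'))
        = γ • ((B * (p.2 - p'.2)) • e + (k (sc (γ * B) p) - k (sc (γ * B) p'))) := by
        simp; module
      rw [e1, norm_smul, Real.norm_of_nonneg hγ.le]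
      have h3 : ‖p.2 - p'.2‖ ≤ ‖p - p'‖ := norm_snd_le (p - p')
      have h4 := (hLk _ _).trans (mul_le_mul_of_nonneg_left (sc_lip hκ.le hκ1 p p') hLk0)
      calc _ ≤ γ * (B * ‖p - p'‖ * ‖e‖ + Lk * ‖p - p'‖) := by
            gcongr
            refine (norm_add_le _ _).trans (add_le_add ?_ h4)
            rw [norm_smul, norm_mul, Real.norm_of_nonneg hB0.le]
            gcongr
        _ = γ * (B * ‖e‖ + Lk) * ‖p - p'‖ := by ring
        _ ≤ _ := by gcongr)
    (fun p p' hp hp' => by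
      rw [hθe]
      have e1 : ((Cc • ContinuousLinearMap.snd ℝ E ℝ) p + (- c (sc (γ * B) p) * p.2 + b (sc (γ * B) p) / B)) - ((Cc • ContinuousLinearMap.snd ℝ E ℝ) p' + (- c (sc (γ * B) p') * p'.2 + b (sc (γ * B) p') / B))
        = (Cc - c (sc (γ * B) p)) * (p.2 - p'.2) - (c (sc (γ * B) p) - c (sc (γ * B) p')) * p'.2 + (b (sc (γ * B) p) - b (sc (γ * B) p')) / B := by
        simp; ring
      have h3 : ‖p.2 - p'.2‖ ≤ ‖p - p'‖ := norm_snd_le (p - p')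
      have h4 := (hLc _ _).trans (mul_le_mul_of_nonneg_left (sc_lip hκ.le hκ1 p p') hLc0)
      have h5 := (hLb _ _).trans (mul_le_mul_of_nonneg_left (sc_lip hκ.le hκ1 p p') hLb0)
      have h6 : |Cc - c (sc (γ * B) p)| ≤ Cc := by
        have := hCc (sc (γ * B) p)
        have h0 := hc0 (sc (γ * B) p)
        rw [Real.norm_of_nonneg h0] at this
        rw [abs_le]; constructor <;> linarith
      have hn := norm_nonneg (p - p')
      rw [e1]
      calc _ ≤ Cc * ‖p - p'‖ + (Lc * ‖p - p'‖) * A + (Lb * ‖p - p'‖) / B := by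
            refine (norm_add_le _ _).trans (add_le_add ((norm_sub_le _ _).trans (add_le_add ?_ ?_)) ?_)
            · rw [norm_mul]; gcongr; exact h6
            · rw [norm_mul]; gcongr; exact hp'
            · rw [norm_div, Real.norm_of_nonneg hB0.le]; gcongr
        _ = (Cc + Lc * A + Lb / B) * ‖p - p'‖ := by ring
        _ ≤ _ := mul_le_mul_of_nonneg_right (by linarith) hn)
    (fun p hp => by
      have e1 : (((γ * B) • (ContinuousLinearMap.toSpanSingleton ℝ e ∘L ContinuousLinearMap.snd ℝ E ℝ)) p + γ • k (sc (γ * B) p)) = γ • ((B * p.2) • e + k (sc (γ * B) p)) := by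
        simp; module
      rw [e1, norm_smul, Real.norm_of_nonneg hγ.le]
      gcongr
      refine (norm_add_le _ _).trans (add_le_add ?_ (hCk _))
      rw [norm_smul, norm_mul, Real.norm_of_nonneg hB0.le]
      gcongr; exact hp)
    (fun p hp => by
      rw [hA'e]
      have e1 : (Cc • ContinuousLinearMap.snd ℝ E ℝ) p + (- c (sc (γ * B) p) * p.2 + b (sc (γ * B) p) / B) = (Cc - c (sc (γ * B) p)) * p.2 + b (sc (γ * B) p) / B := by
        simp; ring
      have h6 : |Cc - c (sc (γ * B) p)| ≤ Cc := by
        have := hCc (sc (γ * B) p)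
        have h0 := hc0 (sc (γ * B) p)
        rw [Real.norm_of_nonneg h0] at this
        rw [abs_le]; constructor <;> linarith
      rw [e1]
      refine (norm_add_le _ _).trans (add_le_add ?_ ?_)
      · rw [norm_mul]; gcongr; exacts [h6, hp]
      · rw [norm_div, Real.norm_of_nonneg hB0.le]
        exact le_trans (by gcongr; exact hCb _) hCbB)
  refine ⟨ζ, hζ, fun w => (hζb w).trans hA'A.le, fun t₀ t₁ y hy hyd hy0 => H t₀ t₁ y hy (fun t ht hz => ?_) hy0⟩
  convert hyd t ht hz using 2
  · simp [sc]; module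
  · simp [sc, hl]; ring
end
end Slow

namespace Slow
open Topology Manifold
section

abbrev X3 := (ℝ × ℝ × ℝ) × ℝ

theorem exists_bump {S Ω : Set X3} (hS : IsCompact S) (hΩ : IsOpen Ω) (hSΩ : S ⊆ Ω) :
    ∃ ψ : X3 → ℝ, ContDiff ℝ 2 ψ ∧ HasCompactSupport ψ ∧ tsupport ψ ⊆ Ω ∧ (∀ p, 0 ≤ ψ p) ∧
      ∀ᶠ x in 𝓝ˢ S, ψ x = 1 := by
  obtain ⟨T, hT, hST, hTΩ⟩ := exists_compact_between hS hΩ hSΩ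
  obtain ⟨f, h1, h0, hf⟩ := exists_contMDiffMap_one_nhds_of_subset_interior (n := 2) 𝓘(ℝ, X3) hS.isClosed hST
  have hs : tsupport f ⊆ T := closure_minimal (fun x hx => by
    by_contra hn; exact hx (h0 x hn)) hT.isClosed
  exact ⟨f, f.contMDiff.contDiff, hT.of_isClosed_subset (isClosed_tsupport _) hs, hs.trans hTΩ, fun p => (hf p).1, h1⟩

theorem bump_r {K : Set (ℝ × ℝ × ℝ)} (hK : IsCompact K) {ψ : X3 → ℝ} 
    (h : ∀ᶠ x in 𝓝ˢ (K ×ˢ {(0:ℝ)}), ψ x = 1) : ∃ r > 0, ∀ w ∈ K, ∀ y : ℝ, |y| ≤ r → ψ (w, y) = 1 := by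
  obtain ⟨U, hU, hSU, hU1⟩ := mem_nhdsSet_iff_exists.1 h
  obtain ⟨δ, hδ, hδU⟩ := (hK.prod isCompact_singleton).exists_thickening_subset_open hU hSU
  refine ⟨δ / 2, by positivity, fun w hw y hy => hU1 (hδU ?_)⟩
  rw [Metric.mem_thickening_iff]
  refine ⟨(w, 0), ⟨hw, rfl⟩, ?_⟩
  rw [Prod.dist_eq]; simp
  linarith

theorem cutoff_smooth {X Z : Type*} [NormedAddCommGroup X] [NormedSpace ℝ X] [NormedAddCommGroup Z] [NormedSpace ℝ Z]
    {Ω : Set X} {ψ : X → ℝ} (hψ : ContDiff ℝ 2 ψ) (hs : tsupport ψ ⊆ Ω) {f : X → Z} 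
    (hf : ∀ p ∈ Ω, ContDiffAt ℝ 2 f p) : ContDiff ℝ 2 (fun p => ψ p • f p) := by
  rw [contDiff_iff_contDiffAt]
  intro x
  by_cases hx : x ∈ tsupport (fun p => ψ p • f p)
  swap
  · exact contDiffAt_const.congr_of_eventuallyEq (notMem_tsupport_iff_eventuallyEq.1 hx)
  exact hψ.contDiffAt.smul (hf x (hs (tsupport_smul_subset_left ψ f hx)))

theorem cbrt_of_pos {s : ℝ} (hs : 0 < s) : cbrt s = s ^ ((1:ℝ) / 3) := by
  unfold cbrt; rw [Real.sign_of_pos hs, abs_of_pos hs, one_mul]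

theorem cbrt_pow {s : ℝ} (hs : 0 < s) : cbrt s ^ 3 = s := by
  rw [cbrt_of_pos hs, ← Real.rpow_natCast, ← Real.rpow_mul hs.le]; norm_num

theorem cbrt_pos {s : ℝ} (hs : 0 < s) : 0 < cbrt s := by
  rw [cbrt_of_pos hs]; positivity

theorem pos_of_cbrt {s : ℝ} (hs : 0 < cbrt s) : 0 < s := by
  by_contra hn
  push Not at hn
  have h1 : Real.sign s ≤ 0 := by
    rcases hn.lt_or_eq with h | h
    · rw [Real.sign_of_neg h]; norm_num
    · rw [h]; simp
  have h2 : 0 ≤ |s| ^ ((1:ℝ) / 3) := by positivity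
  unfold cbrt at hs
  nlinarith

theorem eq_cbrt {m s : ℝ} (hs : 0 < s) (h : m ^ 3 = s) : m = cbrt s := by
  have h3 := cbrt_pow hs
  rw [← h3] at h
  exact (Odd.strictMono_pow (R := ℝ) (n := 3) (by decide)).injective h

theorem cbrt_contDiffAt {s : ℝ} (hs : 0 < s) : ContDiffAt ℝ 2 cbrt s := by
  have h : ContDiffAt ℝ 2 (fun s : ℝ => s ^ ((1:ℝ) / 3)) s := Real.contDiffAt_rpow_const_of_ne hs.ne'
  exact h.congr_of_eventuallyEq ((lt_mem_nhds hs).mono fun x hx => cbrt_of_pos hx)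

def q (I : ℝ) (p : X3) : ℝ := (I - gK * (p.1.1 - EK) * p.1.2.2 ^ 4 - gL * (p.1.1 - EL) - p.2) / ((p.1.1 - ENa) * p.1.2.1)

def Om (I : ℝ) : Set X3 := {p | p.1.1 ∈ Ioo EK ENa ∧ p.1.2.1 ∈ Ioo (0:ℝ) 1 ∧ 0 < q I p}

theorem q_contDiffAt {I : ℝ} {p : X3} (h1 : p.1.1 < ENa) (h2 : 0 < p.1.2.1) : ContDiffAt ℝ 2 (q I) p := by
  unfold q
  have : (p.1.1 - ENa) * p.1.2.1 ≠ 0 := mul_ne_zero (by linarith) h2.ne'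
  exact ContDiffAt.div (by fun_prop) (by fun_prop) this

theorem Om_open (I : ℝ) : IsOpen (Om I) := by
  rw [isOpen_iff_mem_nhds]
  rintro p ⟨h1, h2, h3⟩
  have c1 : ContinuousAt (fun p : X3 => p.1.1) p := by fun_prop
  have c2 : ContinuousAt (fun p : X3 => p.1.2.1) p := by fun_prop
  have c3 := (q_contDiffAt (I := I) h1.2 h2.1).continuousAt
  filter_upwards [c1.eventually_mem (isOpen_Ioo.mem_nhds h1), c2.eventually_mem (isOpen_Ioo.mem_nhds h2),
    c3.eventually_const_lt h3] with x a b c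
  exact ⟨a, b, c⟩

theorem exp_sub_pos {x : ℝ} (h : 0 < x) : 0 < 1 - Real.exp (-x) := by
  have : Real.exp (-x) < 1 := Real.exp_lt_one_iff.2 (by linarith)
  linarith

theorem ab_m {v : ℝ} (hv : -1 < v) : ContDiffAt ℝ 2 αm v ∧ ContDiffAt ℝ 2 βm v ∧ 0 < αm v + βm v := by
  have h := exp_sub_pos (x := (v + 40) / 10) (by linarith)
  rw [← neg_div] at h
  refine ⟨?_, ?_, ?_⟩
  · unfold αm
    exact ContDiffAt.div (by fun_prop) (by fun_prop) h.ne'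
  · unfold βm; fun_prop
  · unfold αm βm
    have : 0 < v + 40 := by linarith
    positivity

theorem ab_h {v : ℝ} (hv : -1 < v) : ContDiffAt ℝ 2 αh v ∧ ContDiffAt ℝ 2 βh v ∧ 0 < αh v + βh v := by
  refine ⟨?_, ?_, ?_⟩
  · unfold αh; fun_prop
  · unfold βh
    exact ContDiffAt.div (by fun_prop) (by fun_prop) (by positivity)
  · unfold αh βh
    positivity

theorem ab_n {v : ℝ} (hv : -1 < v) : ContDiffAt ℝ 2 αn v ∧ ContDiffAt ℝ 2 βn v ∧ 0 < αn v + βn v := by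
  have h := exp_sub_pos (x := (v + 55) / 10) (by linarith)
  rw [← neg_div] at h
  refine ⟨?_, ?_, ?_⟩
  · unfold αn
    exact ContDiffAt.div (by fun_prop) (by fun_prop) h.ne'
  · unfold βn; fun_prop
  · unfold αn βn
    have : 0 < v + 55 := by linarith
    positivity

theorem inf_t {a b : ℝ → ℝ} {v : ℝ} (h : ContDiffAt ℝ 2 a v ∧ ContDiffAt ℝ 2 b v ∧ 0 < a v + b v) :
    ContDiffAt ℝ 2 (fun v => a v / (a v + b v)) v ∧ ContDiffAt ℝ 2 (fun v => 1 / (a v + b v)) v ∧ 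
      1 / (a v + b v) ≠ 0 := by
  obtain ⟨h1, h2, h3⟩ := h
  exact ⟨h1.div (h1.add h2) h3.ne', contDiffAt_const.div (h1.add h2) h3.ne', by positivity⟩

theorem gate {T : ℝ} (hT : 0 < T) {f t : ℝ → ℝ} {g : X3 → ℝ} {p : X3} 
    (h : ContDiffAt ℝ 2 f p.1.1 ∧ ContDiffAt ℝ 2 t p.1.1 ∧ t p.1.1 ≠ 0) (hg : ContDiffAt ℝ 2 g p) :
    ContDiffAt ℝ 2 (fun p : X3 => (f p.1.1 - g p) / (T * t p.1.1)) p := by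
  obtain ⟨h1, h2, h3⟩ := h
  have c1 : ContDiffAt ℝ 2 (fun p : X3 => p.1.1) p := by fun_prop
  have d1 : ContDiffAt ℝ 2 (fun p : X3 => f p.1.1) p := h1.comp p c1
  have d2 : ContDiffAt ℝ 2 (fun p : X3 => t p.1.1) p := h2.comp p c1
  exact (d1.sub hg).div (contDiffAt_const.mul d2) (mul_ne_zero hT.ne' h3)

def Mf (I : ℝ) (p : X3) : ℝ := cbrt (q I p)
def am (I Tm : ℝ) (p : X3) : ℝ := (minf p.1.1 - Mf I p) / (Tm * tmhat p.1.1)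
def ah (Th : ℝ) (p : X3) : ℝ := (hinf p.1.1 - p.1.2.1) / (Th * thhat p.1.1)
def an (Tn : ℝ) (p : X3) : ℝ := (ninf p.1.1 - p.1.2.2) / (Tn * tnhat p.1.1)

theorem Mf_smooth {I : ℝ} {p : X3} (hp : p ∈ Om I) : ContDiffAt ℝ 2 (Mf I) p :=
  (cbrt_contDiffAt hp.2.2).comp p (q_contDiffAt hp.1.2 hp.2.1.1)

theorem v_gt {I : ℝ} {p : X3} (hp : p ∈ Om I) : -1 < p.1.1 := by
  have := hp.1.1; unfold EK at this; linarith

theorem am_smooth {I Tm : ℝ} (hT : 0 < Tm) {p : X3} (hp : p ∈ Om I) : ContDiffAt ℝ 2 (am I Tm) p :=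
  gate hT (inf_t (ab_m (v_gt hp))) (Mf_smooth hp)

theorem ah_smooth {I Tm : ℝ} (hT : 0 < Tm) {p : X3} (hp : p ∈ Om I) : ContDiffAt ℝ 2 (ah Tm) p :=
  gate hT (inf_t (ab_h (v_gt hp))) (by fun_prop)

theorem an_smooth {I Tm : ℝ} (hT : 0 < Tm) {p : X3} (hp : p ∈ Om I) : ContDiffAt ℝ 2 (an Tm) p :=
  gate hT (inf_t (ab_n (v_gt hp))) (by fun_prop)

def cf (I : ℝ) (p : X3) : ℝ := q I p * p.1.2.1 + gK * p.1.2.2 ^ 4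
def bf (I ε δh δn Tm Th Tn : ℝ) (p : X3) : ℝ := 
  -(p.1.1 - ENa) * (3 * Mf I p ^ 2) * p.1.2.1 * am I Tm p - (p.1.1 - ENa) * q I p * (ε * δh * ah Th p)
   - 4 * gK * (p.1.1 - EK) * p.1.2.2 ^ 3 * (ε * δn * an Tn p)
def kf (ε δh δn Th Tn : ℝ) (p : X3) : ℝ × ℝ × ℝ := (0, ε * δh * ah Th p, ε * δn * an Tn p)

theorem cf_smooth {I : ℝ} {p : X3} (hp : p ∈ Om I) : ContDiffAt ℝ 2 (cf I) p := by
  have := q_contDiffAt (I := I) hp.1.2 hp.2.1.1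
  unfold cf; fun_prop

theorem bf_smooth {I ε δh δn Tm Th Tn : ℝ} (hTm : 0 < Tm) (hTh : 0 < Th) (hTn : 0 < Tn) {p : X3} (hp : p ∈ Om I) :
    ContDiffAt ℝ 2 (bf I ε δh δn Tm Th Tn) p := by
  have := q_contDiffAt (I := I) hp.1.2 hp.2.1.1
  have := Mf_smooth hp
  have := am_smooth hTm hp
  have := ah_smooth hTh hp
  have := an_smooth hTn hp
  unfold bf; fun_prop

theorem kf_smooth {I ε δh δn Th Tn : ℝ} (hTh : 0 < Th) (hTn : 0 < Tn) {p : X3} (hp : p ∈ Om I) :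
    ContDiffAt ℝ 2 (kf ε δh δn Th Tn) p := by
  have := ah_smooth hTh hp
  have := an_smooth hTn hp
  unfold kf; fun_prop

theorem q_V {I v m h n : ℝ} (hv : v ≠ ENa) (hh : h ≠ 0) : q I ((v, h, n), V I v m h n) = m ^ 3 := by
  have : v - ENa ≠ 0 := sub_ne_zero.2 hv
  simp only [q, V]
  rw [div_eq_iff (by positivity)]; ring

theorem q_inj {I : ℝ} {w : ℝ × ℝ × ℝ} {y y' : ℝ} (hv : w.1 ≠ ENa) (hh : w.2.1 ≠ 0) 
    (h : q I (w, y) = q I (w, y')) : y = y' := by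
  have h1 : w.1 - ENa ≠ 0 := sub_ne_zero.2 hv
  simp only [q] at h
  rw [div_left_inj' (mul_ne_zero h1 hh)] at h
  linarith

theorem V_deriv {I : ℝ} {fv fm fh fn : ℝ → ℝ} {dv dm dh dn t : ℝ} (hv : HasDerivAt fv dv t)
    (hm : HasDerivAt fm dm t) (hh : HasDerivAt fh dh t) (hn : HasDerivAt fn dn t) : 
    HasDerivAt (fun t => V I (fv t) (fm t) (fh t) (fn t)) 
      (-(fm t ^ 3 * fh t + gK * fn t ^ 4 + gL) * dv - (fv t - ENa) * (3 * fm t ^ 2) * fh t * dm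
        - (fv t - ENa) * fm t ^ 3 * dh - 4 * gK * (fv t - EK) * fn t ^ 3 * dn) t := by
  unfold V
  have := (((((hv.sub_const ENa).mul (hm.pow 3)).mul hh).const_sub I).sub
    (((hv.sub_const EK).const_mul gK).mul (hn.pow 4))).sub ((hv.sub_const EL).const_mul gL)
  refine HasDerivAt.congr_deriv this ?_
  simp only [Pi.mul_apply, Pi.pow_apply]
  push_cast
  ring
end
end Slow

/-- existence of a slow manifold `m = μ_γ(v,h,n)`, `O(γ)`-close to `μ` on `K`,
whose graph is locally invariant under the flow of the four-dimensional system. -/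
theorem stmt0 (I ε δh δn Tm Th Tn : ℝ)
    (hε : 0 < ε) (hδh : 0 < δh) (hδn : 0 < δn)
    (hTm : 0 < Tm) (hTh : 0 < Th) (hTn : 0 < Tn)
    (D : Set (ℝ × ℝ × ℝ × ℝ)) (hDcpt : IsCompact D)
    (hDsub : ∀ p ∈ D, p.1 ∈ Set.Ioo EK ENa ∧ p.2.1 ∈ Set.Ioo (0:ℝ) 1 ∧
      p.2.2.1 ∈ Set.Ioo (0:ℝ) 1 ∧ p.2.2.2 ∈ Set.Ioo (0:ℝ) 1)
    (K : Set (ℝ × ℝ × ℝ)) (hKcpt : IsCompact K)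
    (hKsub : ∀ p ∈ K, p.1 ∈ Set.Ioo EK ENa ∧ p.2.1 ∈ Set.Ioo (0:ℝ) 1 ∧
      p.2.2 ∈ Set.Ioo (0:ℝ) 1 ∧ μfun I p.1 p.2.1 p.2.2 ∈ Set.Ioo (0:ℝ) 1) :
    ∃ γ₀ > (0:ℝ), ∃ C > (0:ℝ), ∀ γ ∈ Set.Ioo (0:ℝ) γ₀,
      ∃ μγ : ℝ × ℝ × ℝ → ℝ, ContDiff ℝ 1 μγ ∧
        (∀ p ∈ K, |μγ p - μfun I p.1 p.2.1 p.2.2| ≤ C * γ) ∧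
        (∀ t₀ t₁ : ℝ, ∀ fv fm fh fn : ℝ → ℝ,
          (∀ t ∈ Set.Icc t₀ t₁, HasDerivAt fv (V I (fv t) (fm t) (fh t) (fn t)) t) →
          (∀ t ∈ Set.Icc t₀ t₁,
            HasDerivAt fm (γ * ((minf (fv t) - fm t) / (Tm * tmhat (fv t)))) t) →
          (∀ t ∈ Set.Icc t₀ t₁,
            HasDerivAt fh (γ * ε * δh * ((hinf (fv t) - fh t) / (Th * thhat (fv t)))) t) →
          (∀ t ∈ Set.Icc t₀ t₁,
            HasDerivAt fn (γ * ε * δn * ((ninf (fv t) - fn t) / (Tn * tnhat (fv t)))) t) →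
          (∀ t ∈ Set.Icc t₀ t₁, (fv t, fh t, fn t) ∈ K) →
          fm t₀ = μγ (fv t₀, fh t₀, fn t₀) →
          ∀ t ∈ Set.Icc t₀ t₁, fm t = μγ (fv t, fh t, fn t)) := by
  have hKΩ : K ×ˢ {(0:ℝ)} ⊆ Slow.Om I := by
    rintro ⟨w, y⟩ ⟨hw, hy⟩
    simp only [mem_singleton_iff] at hy
    subst hy
    obtain ⟨h1, h2, h3, h4⟩ := hKsub w hw
    refine ⟨h1, h2, ?_⟩
    have := Slow.pos_of_cbrt h4.1
    simpa [Slow.q] using this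
  obtain ⟨ψ, hψ, hψc, hψs, hψ0, hψ1⟩ := Slow.exists_bump (hKcpt.prod isCompact_singleton) (Slow.Om_open I) hKΩ
  obtain ⟨r, hr, hψr⟩ := Slow.bump_r hKcpt hψ1
  have hOm : ∀ w ∈ K, ∀ y : ℝ, |y| ≤ r → (w, y) ∈ Slow.Om I := fun w hw y hy => by
    apply hψs; apply subset_tsupport
    rw [Function.mem_support, hψr w hw y hy]; norm_num
  have hc := Slow.cutoff_smooth hψ hψs (f := Slow.cf I) (fun p hp => Slow.cf_smooth hp)
  have hb := Slow.cutoff_smooth hψ hψs (f := Slow.bf I ε δh δn Tm Th Tn) (fun p hp => Slow.bf_smooth hTm hTh hTn hp)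
  have hk := Slow.cutoff_smooth hψ hψs (f := Slow.kf ε δh δn Th Tn) (fun p hp => Slow.kf_smooth hTh hTn hp)
  have hM := Slow.cutoff_smooth hψ hψs (f := Slow.Mf I) (fun p hp => Slow.Mf_smooth hp)
  have hMc : HasCompactSupport (fun p => ψ p • Slow.Mf I p) := hψc.smul_right
  obtain ⟨_, LM, _, hLM0, _, hLM⟩ := Slow.bl hM hMc
  have hgL : 0 < gL := by unfold gL; norm_num
  have hgK : 0 < gK := by unfold gK; norm_num
  obtain ⟨A, hA, B, hB, γ₀, hγ₀, H⟩ := Slow.slow_abs hgL ((1, 0, 0) : ℝ × ℝ × ℝ) hc hψc.smul_right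
    (fun p => by
      by_cases hp : ψ p = 0
      · simp [hp]
      · have hpΩ : p ∈ Slow.Om I := hψs (subset_tsupport _ hp)
        have h1 := hpΩ.2.2
        have h2 := hpΩ.2.1.1
        have h3 := hψ0 p
        simp only [smul_eq_mul, Slow.cf]
        have : 0 ≤ p.1.2.2 ^ 4 := by positivity
        positivity)
    hb hψc.smul_right hk hψc.smul_right
  refine ⟨min γ₀ (r / (B * A)), by positivity, LM * B * A + 1, by positivity, ?_⟩
  rintro γ ⟨hγ, hγ1⟩
  have hγr : γ * B * A ≤ r := by
    have := hγ1.le.trans (min_le_right _ _)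
    rw [le_div_iff₀ (by positivity)] at this
    linarith
  obtain ⟨ζ, hζ, hζA, Hζ⟩ := H γ ⟨hγ, hγ1.trans_le (min_le_left _ _)⟩
  have hsm : ∀ z : ℝ, |z| ≤ A → |γ * B * z| ≤ r := fun z hz => by
    rw [abs_mul, abs_of_pos (by positivity : 0 < γ * B)]
    exact le_trans (by gcongr) hγr
  refine ⟨fun w => ψ (w, γ * B * ζ w) • Slow.Mf I (w, γ * B * ζ w), ?_, ?_, ?_⟩
  · have h1 : ContDiff ℝ 1 (fun w : ℝ × ℝ × ℝ => (w, γ * B * ζ w)) := by fun_prop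
    exact (hM.of_le (by norm_num)).comp h1
  · intro w hw
    have h1 := hLM (w, γ * B * ζ w) (w, 0)
    have h2 : ψ (w, 0) • Slow.Mf I (w, 0) = μfun I w.1 w.2.1 w.2.2 := by
      rw [hψr w hw 0 (by simpa using hr.le)]
      simp [Slow.Mf, Slow.q, μfun]
    rw [h2] at h1
    refine h1.trans ?_
    have h3 : ‖((w, γ * B * ζ w) : Slow.X3) - (w, 0)‖ ≤ γ * B * A := by
      rw [Prod.norm_def]
      apply max_le
      · simp; positivity
      · simp only [Prod.snd_sub, sub_zero]
        rw [Real.norm_eq_abs, abs_mul, abs_of_pos (by positivity : 0 < γ * B)]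
        gcongr; exact hζA w
    have h4 := mul_le_mul_of_nonneg_left h3 hLM0
    nlinarith
  · intro t₀ t₁ fv fm fh fn hv hm hh hn hK hm0
    have hγB : 0 < γ * B := by positivity
    set w : ℝ → ℝ × ℝ × ℝ := fun t => (fv t, fh t, fn t) with hw
    set z : ℝ → ℝ := fun t => V I (fv t) (fm t) (fh t) (fn t) / (γ * B) with hz
    have hzV : ∀ t, γ * B * z t = V I (fv t) (fm t) (fh t) (fn t) := fun t => by
      simp only [hz]; field_simp
    have hvne : ∀ t ∈ Icc t₀ t₁, fv t ≠ ENa := fun t ht => (hKsub _ (hK t ht)).1.2.ne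
    have hhne : ∀ t ∈ Icc t₀ t₁, fh t ≠ 0 := fun t ht => (hKsub _ (hK t ht)).2.1.1.ne'
    have hq : ∀ t ∈ Icc t₀ t₁, Slow.q I (w t, γ * B * z t) = fm t ^ 3 := fun t ht => by
      rw [hzV]; exact Slow.q_V (hvne t ht) (hhne t ht)
    have hMm : ∀ t ∈ Icc t₀ t₁, |z t| ≤ A → Slow.Mf I (w t, γ * B * z t) = fm t := fun t ht hzt => by
      have h1 := hOm _ (hK t ht) _ (hsm _ hzt)
      exact (Slow.eq_cbrt h1.2.2 (hq t ht).symm).symm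
    have hd : ∀ t ∈ Icc t₀ t₁, HasDerivAt (fun t => (w t, z t)) 
      ((V I (fv t) (fm t) (fh t) (fn t), γ * ε * δh * ((hinf (fv t) - fh t) / (Th * thhat (fv t))),
        γ * ε * δn * ((ninf (fv t) - fn t) / (Tn * tnhat (fv t)))), 
        (-(fm t ^ 3 * fh t + gK * fn t ^ 4 + gL) * V I (fv t) (fm t) (fh t) (fn t) 
        - (fv t - ENa) * (3 * fm t ^ 2) * fh t * (γ * ((minf (fv t) - fm t) / (Tm * tmhat (fv t))))
        - (fv t - ENa) * fm t ^ 3 * (γ * ε * δh * ((hinf (fv t) - fh t) / (Th * thhat (fv t)))) 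
        - 4 * gK * (fv t - EK) * fn t ^ 3 * (γ * ε * δn * ((ninf (fv t) - fn t) / (Tn * tnhat (fv t)))))
        / (γ * B)) t := by
      intro t ht
      exact ((hv t ht).prodMk ((hh t ht).prodMk (hn t ht))).prodMk
        ((Slow.V_deriv (hv t ht) (hm t ht) (hh t ht) (hn t ht)).div_const _)
    have key : t₀ ≤ t₁ → ∀ t ∈ Icc t₀ t₁, z t = ζ (w t) := by
      intro h01
      refine Hζ t₀ t₁ (fun t => (w t, z t)) (fun t ht => (hd t ht).continuousAt.continuousWithinAt) ?_ ?_
      · intro t ht hzt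
        refine (hd t ht).congr_deriv ?_
        have e1 := hψr _ (hK t ht) _ (hsm _ hzt)
        have e2 := hMm t ht hzt
        have e3 := hq t ht
        simp only [] at hzt ⊢
        rw [e1]
        simp only [one_smul, Slow.cf, Slow.bf, Slow.kf, Slow.am, Slow.ah, Slow.an, e2, e3]
        rw [← hzV t]
        refine Prod.ext ?_ ?_
        · simp [hw]
          refine ⟨by ring, by ring, by ring⟩
        · simp only [hw]
          field_simp
          ring
      · have ht : t₀ ∈ Icc t₀ t₁ := ⟨le_rfl, h01⟩
        have e1 := hψr _ (hK t₀ ht) _ (hsm _ (hζA (w t₀)))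
        have e4 := hOm _ (hK t₀ ht) _ (hsm _ (hζA (w t₀)))
        have e1 : ψ (w t₀, γ * B * ζ (w t₀)) = 1 := e1
        have hm0 : fm t₀ = ψ (w t₀, γ * B * ζ (w t₀)) • Slow.Mf I (w t₀, γ * B * ζ (w t₀)) := hm0
        rw [e1, one_smul] at hm0
        have e2 : fm t₀ ^ 3 = Slow.q I (w t₀, γ * B * ζ (w t₀)) := by
          rw [hm0]; exact Slow.cbrt_pow e4.2.2
        rw [← hq t₀ ht] at e2
        have := Slow.q_inj (hvne t₀ ht) (hhne t₀ ht) e2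
        exact mul_left_cancel₀ hγB.ne' this
    intro t ht
    have e := key (ht.1.trans ht.2) t ht
    have hzt : |z t| ≤ A := by rw [e]; exact hζA _
    have e1 := hψr _ (hK t ht) _ (hsm _ hzt)
    have e2 := hMm t ht hzt
    rw [e] at e1 e2
    show fm t = ψ (w t, γ * B * ζ (w t)) • Slow.Mf I (w t, γ * B * ζ (w t))
    have e1 : ψ (w t, γ * B * ζ (w t)) = 1 := e1
    rw [e1, e2, one_smul]
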